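/- arXiv:0706.3338 — 2 statements merged into one kernel-verified Lean document; each statement's English description precedes it below -/
import Mathlib

section
/- Let Φ be a finitely generated free group, x a finite set, and P = ⟨x, Φ; R⟩ an M_Φ-presentation. Then the group G = G(P) is a retract of a group of the form L ⋊ ℤ, where L is a finitely generated free group; in particular G is a retract of a finitely generated free-by-(infinite cyclic) group. -/
open Monoid

section Defs
variable {X Y H : Type*}

/-- `φ_W^θ(j)`: the sum `Σ_{i=1}^{j} ε_i θ(x_i)` of the weights of the first `j`
letters of the word `W` (a word is a nonempty list of pairs (letter, exponent sign)). -/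
def phiW (θ : X → ℤ) (W : List (X × Bool)) (j : ℕ) : ℤ :=
  ((W.take j).map fun p => if p.2 then θ p.1 else -θ p.1).sum

/-- A weight function: a map `θ : X → ℤ` whose image generates the additive group `ℤ`. -/
def IsWeightFun (θ : X → ℤ) : Prop :=
  AddSubgroup.closure (Set.range θ) = ⊤

/-- A strict weight function: `θ x ≠ 0` for all `x`. -/
def IsStrictWeight (θ : X → ℤ) : Prop := ∀ x, θ x ≠ 0

/-- `θ` is admissible for `W` if `φ(r) = 0` where `r` is the length of `W`. -/
def IsAdmissible (θ : X → ℤ) (W : List (X × Bool)) : Prop :=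
  phiW θ W W.length = 0

/-- The successor of an index, cyclically (subscripts mod `r`). -/
def succIdx (W : List (X × Bool)) (k : Fin W.length) : Fin W.length :=
  ⟨(k.1 + 1) % W.length, Nat.mod_lt _ k.pos⟩

/-- `W` has the unique max-min property with respect to the weight function `θ`:
`θ` is a strict weight function, admissible for `W`, the graph of `W` has a unique
maximum at `k` and a unique minimum at `l`, and `W` is reduced at the maximum and
minimum (`x_k ≠ x_{k+1}`, `x_l ≠ x_{l+1}`, subscripts mod `r`). -/
def UniqueMaxMinWith (θ : X → ℤ) (W : List (X × Bool)) : Prop :=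
  W ≠ [] ∧ IsWeightFun θ ∧ IsStrictWeight θ ∧ IsAdmissible θ W ∧
  ∃ k l : Fin W.length,
    (∀ j : Fin W.length, j ≠ k → phiW θ W (j.1 + 1) < phiW θ W (k.1 + 1)) ∧
    (∀ j : Fin W.length, j ≠ l → phiW θ W (l.1 + 1) < phiW θ W (j.1 + 1)) ∧
    (W.get k).1 ≠ (W.get (succIdx W k)).1 ∧
    (W.get l).1 ≠ (W.get (succIdx W l)).1

/-- `W` has the unique max-min property: it has it with respect to some
admissible strict weight function. -/
def HasUniqueMaxMin (W : List (X × Bool)) : Prop :=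
  ∃ θ : X → ℤ, UniqueMaxMinWith θ W

/-- The `x`-skeleton of a relator `R = x₁^{ε₁} h₁ ⋯ x_r^{ε_r} h_r`
(encoded as the list of triples `(xᵢ, εᵢ, hᵢ)`): the word `x₁^{ε₁} ⋯ x_r^{ε_r}`. -/
def skel (R : List (X × Bool × H)) : List (X × Bool) :=
  R.map fun t => (t.1, t.2.1)

variable [Group H]

/-- The element of the free product `H ∗ F(X)` represented by the relator
`R = x₁^{ε₁} h₁ ⋯ x_r^{ε_r} h_r`. -/
def relWord (R : List (X × Bool × H)) : Coprod H (FreeGroup X) :=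
  (R.map fun t => Coprod.inr (FreeGroup.mk [(t.1, t.2.1)]) * Coprod.inl t.2.2).prod

/-- The group `G(P)` defined by the relative one-relator presentation
`P = ⟨x, H; R⟩`: the quotient of `H ∗ F(X)` by the normal closure of `R`. -/
def relGroup (R : List (X × Bool × H)) : Type _ :=
  Coprod H (FreeGroup X) ⧸ Subgroup.normalClosure {relWord R}

instance (R : List (X × Bool × H)) : Group (relGroup R) :=
  QuotientGroup.Quotient.group _

/-- The natural homomorphism `ν : H → G(P)`. -/
def natHom (R : List (X × Bool × H)) : H →* relGroup R :=
  (QuotientGroup.mk' _).comp Coprod.inl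

end Defs

namespace UniqueMaxMin

section Automorphisms
variable {S : Type*}

/-- `w` if `ε` is true, `w⁻¹` otherwise. -/
def signed {L : Type*} [Group L] (ε : Bool) (w : L) : L := if ε then w else w⁻¹

lemma map_signed {L K : Type*} [Group L] [Group K] (f : L →* K) (ε : Bool) (w : L) :
    f (signed ε w) = signed ε (f w) := by
  cases ε <;> simp [signed]

@[simp] lemma signed_signed {L : Type*} [Group L] (ε : Bool) (w : L) :
    signed ε (signed ε w) = w := by
  cases ε <;> simp [signed]

lemma signed_mem {L : Type*} [Group L] {C : Subgroup L} (ε : Bool) {w : L} (h : w ∈ C) :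
    signed ε w ∈ C := by
  cases ε <;> simpa [signed] using h

/-- The subgroup of the free group generated by all free generators other than `i`. -/
def without (i : S) : Subgroup (FreeGroup S) :=
  Subgroup.closure (FreeGroup.of '' {i}ᶜ)

lemma of_mem_without {i j : S} (h : j ≠ i) : FreeGroup.of j ∈ without i :=
  Subgroup.subset_closure ⟨j, h, rfl⟩

/-- `w` involves the free generator `i` exactly once. -/
def LinearIn (i : S) (w : FreeGroup S) : Prop :=
  ∃ ε : Bool, ∃ a ∈ without i, ∃ b ∈ without i, w = a * signed ε (FreeGroup.of i) * b

lemma LinearIn.mul_right {i : S} {w c : FreeGroup S} (h : LinearIn i w) (hc : c ∈ without i) :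
    LinearIn i (w * c) := by
  obtain ⟨ε, a, ha, b, hb, rfl⟩ := h
  exact ⟨ε, a, ha, b * c, mul_mem hb hc, by group⟩

lemma LinearIn.mul_left {i : S} {w c : FreeGroup S} (h : LinearIn i w) (hc : c ∈ without i) :
    LinearIn i (c * w) := by
  obtain ⟨ε, a, ha, b, hb, rfl⟩ := h
  exact ⟨ε, c * a, mul_mem hc ha, b, hb, by group⟩

lemma LinearIn.inv {i : S} {w : FreeGroup S} (h : LinearIn i w) : LinearIn i w⁻¹ := by
  obtain ⟨ε, a, ha, b, hb, rfl⟩ := h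
  refine ⟨!ε, b⁻¹, inv_mem hb, a⁻¹, inv_mem ha, ?_⟩
  cases ε <;> simp [signed, mul_assoc]

lemma LinearIn.apply_signed {i : S} {w : FreeGroup S} (h : LinearIn i w) (ε : Bool) :
    LinearIn i (signed ε w) := by
  cases ε
  · simpa [signed] using h.inv
  · simpa [signed] using h

lemma linearIn_of (i : S) : LinearIn i (FreeGroup.of i) :=
  ⟨true, 1, one_mem _, 1, one_mem _, by simp [signed]⟩

lemma LinearIn.list_prod {i : S} (w : List (FreeGroup S)) (l : ℕ) (hl : l < w.length)
    (hlin : LinearIn i w[l])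
    (h : ∀ (j : ℕ) (hj : j < w.length), j ≠ l → w[j] ∈ without i) : LinearIn i w.prod := by
  induction w generalizing l with
  | nil => simp at hl
  | cons a w ih =>
    rw [List.prod_cons]
    cases l with
    | zero =>
      refine LinearIn.mul_right hlin (Subgroup.list_prod_mem _ fun x hx => ?_)
      obtain ⟨j, hj, rfl⟩ := List.getElem_of_mem hx
      exact h (j + 1) (by simpa using hj) (by simp)
    | succ l =>
      refine LinearIn.mul_left (ih l (by simpa using hl) hlin fun j hj hjl => ?_)
        (h 0 (by simp) (by simp))
      exact h (j + 1) (by simpa using hj) (by simpa using hjl)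

lemma map_eq_of_mem_without {i : S} {f : FreeGroup S →* FreeGroup S}
    (hf : ∀ j ≠ i, f (FreeGroup.of j) = FreeGroup.of j) {a : FreeGroup S}
    (ha : a ∈ without i) : f a = a := by
  refine MonoidHom.eqOn_closure (f := f) (g := MonoidHom.id _) ?_ ha
  rintro _ ⟨j, hj, rfl⟩
  exact hf j hj

/-- Replacing a free generator by a word involving it exactly once is an automorphism. -/
lemma LinearIn.exists_mulAut {i : S} {w : FreeGroup S} (h : LinearIn i w) :
    ∃ T : MulAut (FreeGroup S), T (FreeGroup.of i) = w ∧
      ∀ j ≠ i, T (FreeGroup.of j) = FreeGroup.of j := by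
  classical
  obtain ⟨ε, a, ha, b, hb, rfl⟩ := h
  have fix : ∀ (w : FreeGroup S), ∀ j ≠ i,
      FreeGroup.lift (Function.update FreeGroup.of i w) (FreeGroup.of j) = FreeGroup.of j := by
    intro w j hj
    simp [hj]
  set f := FreeGroup.lift (Function.update FreeGroup.of i (a * signed ε (FreeGroup.of i) * b))
    with hf
  set g := FreeGroup.lift
    (Function.update FreeGroup.of i (signed ε (a⁻¹ * FreeGroup.of i * b⁻¹))) with hg
  have fi : f (FreeGroup.of i) = a * signed ε (FreeGroup.of i) * b := by simp [hf]
  have gi : g (FreeGroup.of i) = signed ε (a⁻¹ * FreeGroup.of i * b⁻¹) := by simp [hg]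
  have fj := fix (a * signed ε (FreeGroup.of i) * b)
  have gj := fix (signed ε (a⁻¹ * FreeGroup.of i * b⁻¹))
  rw [← hf] at fj
  rw [← hg] at gj
  have gf : g.comp f = MonoidHom.id _ := by
    ext j
    by_cases hj : j = i
    · subst hj
      simp only [MonoidHom.comp_apply, fi, map_mul, map_signed, gi, signed_signed,
        map_eq_of_mem_without gj ha, map_eq_of_mem_without gj hb, MonoidHom.id_apply]
      group
    · simp only [MonoidHom.comp_apply, fj j hj, gj j hj, MonoidHom.id_apply]
  have fg : f.comp g = MonoidHom.id _ := by
    ext j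
    by_cases hj : j = i
    · subst hj
      simp only [MonoidHom.comp_apply, fi, map_mul, map_inv, map_signed, gi,
        map_eq_of_mem_without fj ha, map_eq_of_mem_without fj hb, MonoidHom.id_apply]
      rw [show a⁻¹ * (a * signed ε (FreeGroup.of j) * b) * b⁻¹ = signed ε (FreeGroup.of j) by
        group, signed_signed]
    · simp only [MonoidHom.comp_apply, fj j hj, gj j hj, MonoidHom.id_apply]
  exact ⟨MonoidHom.toMulEquiv f g gf fg, fi, fj⟩

end Automorphisms

section Heights
variable {X H : Type*}

lemma phiW_zero (θ : X → ℤ) (W : List (X × Bool)) : phiW θ W 0 = 0 := by simp [phiW]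

lemma phiW_cons (θ : X → ℤ) (a : X × Bool) (W : List (X × Bool)) (j : ℕ) :
    phiW θ (a :: W) (j + 1) = (if a.2 then θ a.1 else -θ a.1) + phiW θ W j := by
  simp [phiW]

lemma phiW_succ (θ : X → ℤ) (W : List (X × Bool)) (j : ℕ) (hj : j < W.length) :
    phiW θ W (j + 1) = phiW θ W j + if W[j].2 then θ W[j].1 else -θ W[j].1 := by
  rw [phiW, ← List.take_append_getElem hj, List.map_append, List.sum_append]
  simp [phiW]

lemma phiW_neg (θ : X → ℤ) (W : List (X × Bool)) (j : ℕ) :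
    phiW (fun x => -θ x) W j = -phiW θ W j := by
  induction W generalizing j with
  | nil => simp [phiW]
  | cons a W ih =>
    cases j with
    | zero => simp [phiW]
    | succ j => rw [phiW_cons, phiW_cons, ih]; split <;> ring

/-- The height at which the edge of the graph of `W` labelled by the `j`-th letter, read
in the direction of positive exponent, starts. -/
def source (θ : X → ℤ) (W : List (X × Bool)) (j : Fin W.length) : ℤ :=
  if W[j].2 then phiW θ W j else phiW θ W (j + 1)

lemma source_neg (θ : X → ℤ) (W : List (X × Bool)) (j : Fin W.length) :
    source (fun x => -θ x) W j = -source θ W j := by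
  unfold source
  split <;> rw [phiW_neg]

lemma source_cases (θ : X → ℤ) (W : List (X × Bool)) (j : Fin W.length) :
    (source θ W j = phiW θ W j ∧ source θ W j + θ W[j].1 = phiW θ W (j + 1)) ∨
    (source θ W j = phiW θ W (j + 1) ∧ source θ W j + θ W[j].1 = phiW θ W j) := by
  have h := phiW_succ θ W j j.2
  unfold source
  rw [h]
  by_cases hε : W[j].2
  · left; simp_all
  · right; simp_all

lemma phiW_succIdx {θ : X → ℤ} {W : List (X × Bool)} (hθ : IsAdmissible θ W)
    (k : Fin W.length) : phiW θ W (succIdx W k) = phiW θ W (k + 1) := by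
  rcases Nat.lt_or_ge (k.1 + 1) W.length with h | h
  · simp [succIdx, Nat.mod_eq_of_lt h]
  · have h' : k.1 + 1 = W.length := by omega
    simp only [succIdx, h', Nat.mod_self, phiW_zero]
    exact hθ.symm

lemma exists_succIdx (W : List (X × Bool)) (j : Fin W.length) : ∃ i, succIdx W i = j := by
  rcases Nat.eq_zero_or_pos j.1 with h | h
  · refine ⟨⟨W.length - 1, by omega⟩, Fin.ext ?_⟩
    simp [succIdx, h, Nat.sub_add_cancel (show 1 ≤ W.length by omega)]
  · refine ⟨⟨j.1 - 1, by omega⟩, Fin.ext ?_⟩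
    simp [succIdx, Nat.sub_add_cancel h, Nat.mod_eq_of_lt j.2]

/-- At a unique, reduced maximum, both incident edges are the highest ones among the edges with
the same label. -/
lemma source_lt_of_max {θ : X → ℤ} {W : List (X × Bool)} (hθ : IsAdmissible θ W)
    {k : Fin W.length}
    (hk : ∀ j : Fin W.length, j ≠ k → phiW θ W (j.1 + 1) < phiW θ W (k.1 + 1))
    (hred : W[k].1 ≠ W[succIdx W k].1) {i j : Fin W.length}
    (hi : i = k ∨ i = succIdx W k) (hij : j ≠ i) (hx : W[j].1 = W[i].1) :
    source θ W j < source θ W i := by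
  have hjk : j ≠ k := by
    rintro rfl
    rcases hi with rfl | rfl
    · exact hij rfl
    · exact hred hx
  have hjk' : j ≠ succIdx W k := by
    rintro rfl
    rcases hi with rfl | rfl
    · exact hred hx.symm
    · exact hij rfl
  have h1 := hk j hjk
  have h2 : phiW θ W j < phiW θ W (k + 1) := by
    obtain ⟨j', rfl⟩ := exists_succIdx W j
    rw [phiW_succIdx hθ]
    exact hk j' fun h => hjk' (by rw [h])
  have h3 : phiW θ W i = phiW θ W (k + 1) ∨ phiW θ W (i + 1) = phiW θ W (k + 1) := by
    rcases hi with rfl | rfl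
    · exact Or.inr rfl
    · exact Or.inl (phiW_succIdx hθ k)
  have h4 := source_cases θ W i
  have h5 := source_cases θ W j
  rw [hx] at h5
  omega

/-- The unique max-min property yields two distinct letters, one having a unique highest
occurrence and the other a unique lowest occurrence. -/
lemma exists_extremal {θ : X → ℤ} {W : List (X × Bool)} (h : UniqueMaxMinWith θ W) :
    ∃ k l : Fin W.length, W[k].1 ≠ W[l].1 ∧
      (∀ j, j ≠ k → W[j].1 = W[k].1 → source θ W j < source θ W k) ∧
      (∀ j, j ≠ l → W[j].1 = W[l].1 → source θ W l < source θ W j) := by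
  obtain ⟨-, -, -, hadm, k, l, hk, hl, hkr, hlr⟩ := h
  have hadm' : IsAdmissible (fun x => -θ x) W := by
    unfold IsAdmissible at *
    rw [phiW_neg, hadm, neg_zero]
  have hl' : ∀ j : Fin W.length, j ≠ l →
      phiW (fun x => -θ x) W (j.1 + 1) < phiW (fun x => -θ x) W (l.1 + 1) := by
    intro j hj
    rw [phiW_neg, phiW_neg]
    exact neg_lt_neg (hl j hj)
  have key : ∃ l', (l' = l ∨ l' = succIdx W l) ∧ W[k].1 ≠ W[l'].1 := by
    by_cases hkl : W[k].1 = W[l].1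
    · exact ⟨_, Or.inr rfl, fun h => hlr (hkl.symm.trans h)⟩
    · exact ⟨l, Or.inl rfl, hkl⟩
  obtain ⟨l', hl'', hne⟩ := key
  refine ⟨k, l', hne, fun j hj hx => source_lt_of_max hadm hk hkr (Or.inl rfl) hj hx,
    fun j hj hx => ?_⟩
  have := source_lt_of_max hadm' hl' hlr hl'' hj hx
  rw [source_neg, source_neg] at this
  omega

/-- Decorate each letter of a relator with the source height of the corresponding edge. -/
def annotate (θ : X → ℤ) : ℤ → List (X × Bool × H) → List (X × ℤ × Bool × H)
  | _, [] => []
  | h, (x, ε, u) :: R =>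
    (x, (if ε then h else h - θ x), ε, u) :: annotate θ (if ε then h + θ x else h - θ x) R

@[simp] lemma length_annotate (θ : X → ℤ) (h : ℤ) (R : List (X × Bool × H)) :
    (annotate θ h R).length = R.length := by
  induction R generalizing h with
  | nil => rfl
  | cons a R ih => simp [annotate, ih]

lemma getElem_annotate (θ : X → ℤ) (h : ℤ) (R : List (X × Bool × H)) (j : ℕ)
    (hj : j < (annotate θ h R).length) (hj' : j < (skel R).length) :
    (annotate θ h R)[j].1 = (skel R)[j].1 ∧
      (annotate θ h R)[j].2.1 = h + source θ (skel R) ⟨j, hj'⟩ := by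
  induction R generalizing h j with
  | nil => simp [annotate] at hj
  | cons a R ih =>
    obtain ⟨x, ε, u⟩ := a
    cases j with
    | zero =>
      cases ε <;> simp [annotate, skel, source, phiW, sub_eq_add_neg]
    | succ j =>
      have hj1 : j < (annotate θ (if ε then h + θ x else h - θ x) R).length := by
        simpa using hj
      have hj2 : j < (skel R).length := by simpa [skel] using hj
      obtain ⟨h1, h2⟩ := ih (if ε then h + θ x else h - θ x) j hj1 hj2
      refine ⟨h1, ?_⟩
      change (annotate θ (if ε then h + θ x else h - θ x) R)[j].2.1 = _
      rw [h2]
      have e1 := phiW_cons θ (x, ε) (skel R)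
      change _ = h + (if (skel R)[j].2 then phiW θ ((x, ε) :: skel R) (j + 1) else
        phiW θ ((x, ε) :: skel R) (j + 1 + 1))
      rw [e1, e1]
      simp only [source, Fin.getElem_fin]
      by_cases hb : (skel R)[j].2 = true
      · cases ε <;> simp [hb] <;> ring
      · cases ε <;> simp [hb] <;> ring

end Heights

section Evaluation
variable {X H L : Type*} [Group H] [Group L]

/-- The value of a decorated letter, given the values of the edges. -/
def evalEdge (ι : H →* L) (Y : X → ℤ → L) (t : X × ℤ × Bool × H) : L :=
  signed t.2.2.1 (Y t.1 t.2.1) * ι t.2.2.2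

lemma map_evalEdge {K : Type*} [Group K] (f : L →* K) (ι : H →* L) (Y : X → ℤ → L)
    (t : X × ℤ × Bool × H) :
    f (evalEdge ι Y t) = evalEdge (f.comp ι) (fun x g => f (Y x g)) t := by
  simp [evalEdge, map_signed]

lemma map_evalEdge_annotate (ι : H →* L) (y : X → L) (θ : X → ℤ) (h : ℤ)
    (R : List (X × Bool × H)) :
    (annotate θ h R).map (evalEdge ι fun x _ => y x) =
      R.map fun t => signed t.2.1 (y t.1) * ι t.2.2 := by
  induction R generalizing h with
  | nil => rfl
  | cons a R ih => simp [annotate, ih, evalEdge]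

lemma mk_eq_signed (x : X) (ε : Bool) : FreeGroup.mk [(x, ε)] = signed ε (FreeGroup.of x) := by
  cases ε
  · simp [signed, FreeGroup.of, FreeGroup.inv_mk, FreeGroup.invRev]
  · rfl

lemma map_relWord {K : Type*} [Group K] (F : Coprod H (FreeGroup X) →* K)
    (R : List (X × Bool × H)) :
    F (relWord R) = (R.map fun t =>
      signed t.2.1 (F (Coprod.inr (FreeGroup.of t.1))) * F (Coprod.inl t.2.2)).prod := by
  rw [relWord, map_list_prod, List.map_map]
  congr 1
  refine List.map_congr_left fun t _ => ?_
  have := map_signed (F.comp Coprod.inr) t.2.1 (FreeGroup.of t.1)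
  simpa [mk_eq_signed] using this

lemma mk_relWord (R : List (X × Bool × H)) :
    QuotientGroup.mk' (Subgroup.normalClosure {relWord R}) (relWord R) = 1 :=
  (QuotientGroup.eq_one_iff _).2 (Subgroup.subset_normalClosure rfl)

lemma map_zpow_apply {K : Type*} [Group K] {σ : MulAut L} {f : L →* K}
    (hf : ∀ w, f (σ w) = f w) (n : ℤ) (w : L) : f ((σ ^ n) w) = f w := by
  have hi : ∀ w, f (σ⁻¹ w) = f w := fun w => by rw [← hf, MulAut.apply_inv_self]
  induction n generalizing w with
  | zero => simp
  | succ n ih => rw [zpow_add_one, MulAut.mul_apply, ih, hf]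
  | pred n ih => rw [zpow_sub_one, MulAut.mul_apply, ih, hi]

lemma zpow_apply_of_fixed {σ : MulAut L} {w : L} (h : σ w = w) (n : ℤ) : (σ ^ n) w = w := by
  have hi : σ⁻¹ w = w := by rw [MulAut.inv_apply, MulEquiv.symm_apply_eq, h]
  induction n with
  | zero => simp
  | succ n ih => rw [zpow_add_one, MulAut.mul_apply, h, ih]
  | pred n ih => rw [zpow_sub_one, MulAut.mul_apply, hi, ih]

lemma zpow_natCast_succ_apply (σ : MulAut L) (n : ℕ) (w : L) :
    (σ ^ ((n + 1 : ℕ) : ℤ)) w = σ ((σ ^ (n : ℤ)) w) := by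
  simp only [zpow_natCast, pow_succ', MulAut.mul_apply]

/-- Rewriting a word in the letters `j (y x) * s ^ θ x` in terms of the conjugates of the `y x`
by powers of `s`. -/
lemma prod_eq_annotate {K : Type*} [Group K] (σ : MulAut L) (j : L →* K) (s : K)
    (hs : ∀ w, s * j w * s⁻¹ = j (σ w)) (ι : H →* L) (hι : ∀ u, σ (ι u) = ι u) (y : X → L)
    (θ : X → ℤ) (R : List (X × Bool × H)) (h : ℤ) :
    s ^ h * (R.map fun t => signed t.2.1 (j (y t.1) * s ^ θ t.1) * j (ι t.2.2)).prod =
      j (((annotate θ h R).map (evalEdge ι fun x g => (σ ^ g) (y x))).prod) *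
        s ^ (h + phiW θ (skel R) R.length) := by
  have hz : ∀ (n : ℤ) w, s ^ n * j w = j ((σ ^ n) w) * s ^ n := by
    have hc : ∀ w, (MulAut.conj s) (j w) = j (σ w) := by simpa using hs
    have hci : ∀ w, (MulAut.conj s)⁻¹ (j w) = j (σ⁻¹ w) := by
      intro w
      rw [MulAut.inv_apply, MulEquiv.symm_apply_eq, hc, MulAut.apply_inv_self]
    intro n w
    have : (MulAut.conj s ^ n) (j w) = j ((σ ^ n) w) := by
      induction n generalizing w with
      | zero => simp
      | succ n ih => rw [zpow_add_one, zpow_add_one, MulAut.mul_apply, hc, ih]; rfl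
      | pred n ih => rw [zpow_sub_one, zpow_sub_one, MulAut.mul_apply, hci, ih]; rfl
    rw [← map_zpow, MulAut.conj_apply] at this
    rw [← this]
    group
  have hcomm : ∀ (n : ℤ) u, s ^ n * j (ι u) = j (ι u) * s ^ n := fun n u => by
    rw [hz, zpow_apply_of_fixed (hι u)]
  induction R generalizing h with
  | nil => simp [annotate, phiW]
  | cons a R ih =>
    obtain ⟨x, ε, u⟩ := a
    have e : phiW θ (skel ((x, ε, u) :: R)) ((x, ε, u) :: R).length =
      (if ε then θ x else -θ x) + phiW θ (skel R) R.length := phiW_cons _ _ _ _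
    have letter : s ^ h * signed ε (j (y x) * s ^ θ x) =
        signed ε (j ((σ ^ (if ε then h else h - θ x)) (y x))) *
          s ^ (if ε then h + θ x else h - θ x) := by
      cases ε
      · simp only [signed, Bool.false_eq_true, if_false]
        rw [eq_inv_mul_iff_mul_eq, mul_inv_rev, ← mul_assoc, ← mul_assoc, mul_inv_eq_iff_eq_mul,
          hz, mul_assoc, ← zpow_sub]
      · simp only [signed, if_true]
        rw [← mul_assoc, hz, mul_assoc, ← zpow_add]
    have next : h + phiW θ (skel ((x, ε, u) :: R)) ((x, ε, u) :: R).length =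
        (if ε then h + θ x else h - θ x) + phiW θ (skel R) R.length := by
      rw [e]
      cases ε <;> simp <;> ring
    rw [next]
    simp only [List.map_cons, List.prod_cons, annotate, map_mul, evalEdge, map_signed]
    rw [← mul_assoc, ← mul_assoc, letter, mul_assoc _ _ (j (ι u)), hcomm, mul_assoc _ _ (s ^ _),
      ← ih]
    group

/-- A group `L` with an automorphism `σ` and a `σ`-invariant homomorphism to `G(P)`, together with
elements of `L` satisfying the rewritten relator, exhibits `G(P)` as a retract of `L ⋊ ℤ`. -/
lemma exists_retract (R : List (X × Bool × H)) (θ : X → ℤ) (hθ : IsAdmissible θ (skel R))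
    (σ : MulAut L) (ι : H →* L) (hι : ∀ u, σ (ι u) = ι u) (y : X → L)
    (f : L →* relGroup R) (hf : ∀ w, f (σ w) = f w) (hfι : f.comp ι = natHom R)
    (hfy : ∀ x, f (y x) = QuotientGroup.mk' _ (Coprod.inr (FreeGroup.of x)))
    (hR : ((annotate θ 0 R).map (evalEdge ι fun x g => (σ ^ g) (y x))).prod = 1) :
    ∃ (μ : relGroup R →* L ⋊[zpowersHom _ σ] Multiplicative ℤ)
      (ρ : L ⋊[zpowersHom _ σ] Multiplicative ℤ →* relGroup R),
      ρ.comp μ = MonoidHom.id (relGroup R) := by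
  let s : L ⋊[zpowersHom _ σ] Multiplicative ℤ := SemidirectProduct.inr (Multiplicative.ofAdd 1)
  have hs : ∀ w, s * SemidirectProduct.inl w * s⁻¹ = SemidirectProduct.inl (σ w) := by
    intro w
    have := SemidirectProduct.inl_aut (φ := zpowersHom _ σ) (Multiplicative.ofAdd 1) w
    simpa [s] using this.symm
  let F : Coprod H (FreeGroup X) →* L ⋊[zpowersHom _ σ] Multiplicative ℤ :=
    Coprod.lift (SemidirectProduct.inl.comp ι)
      (FreeGroup.lift fun x => SemidirectProduct.inl (y x) * s ^ θ x)
  have hF : F (relWord R) = 1 := by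
    rw [map_relWord]
    have := prod_eq_annotate σ SemidirectProduct.inl s hs ι hι y θ R 0
    have h0 : phiW θ (skel R) R.length = 0 := by simpa [IsAdmissible, skel] using hθ
    rw [hR, h0] at this
    simpa [F] using this
  let μ : relGroup R →* L ⋊[zpowersHom _ σ] Multiplicative ℤ :=
    QuotientGroup.lift _ F (Subgroup.normalClosure_le_normal (N := F.ker) (by simpa using hF))
  let ρ : L ⋊[zpowersHom _ σ] Multiplicative ℤ →* relGroup R :=
    SemidirectProduct.lift f 1 (by intro g; ext w; simp [map_zpow_apply hf])
  refine ⟨μ, ρ, QuotientGroup.monoidHom_ext _ (Coprod.hom_ext ?_ ?_)⟩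
  · ext u
    change ρ (F (Coprod.inl u)) = _
    have := DFunLike.congr_fun hfι u
    simp only [F, ρ, Coprod.lift_apply_inl, MonoidHom.comp_apply, SemidirectProduct.lift_inl]
    exact this
  · ext x
    change ρ (F (Coprod.inr (FreeGroup.of x))) = _
    have : ρ (F (Coprod.inr (FreeGroup.of x))) = f (y x) := by simp [F, ρ, s]
    rw [this]
    exact hfy x

end Evaluation

section Construction
variable {A X : Type*} {N : ℕ}

/-- The free generator `i` of the cyclically ordered family. -/
def cyc (A X : Type*) (N : ℕ) (i : ℤ) : FreeGroup (A ⊕ X ⊕ ZMod (2 * N + 1)) :=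
  FreeGroup.of (Sum.inr (Sum.inr i))

/-- The free generators indexed by `X`. -/
def const (A : Type*) (N : ℕ) (x : X) : FreeGroup (A ⊕ X ⊕ ZMod (2 * N + 1)) :=
  FreeGroup.of (Sum.inr (Sum.inl x))

/-- The inclusion of the coefficient group. -/
def incl (A X : Type*) (N : ℕ) : FreeGroup A →* FreeGroup (A ⊕ X ⊕ ZMod (2 * N + 1)) :=
  FreeGroup.map Sum.inl

/-- The homomorphism sending the first `N` cyclic generators to the image of `p` and the other
ones to the image of `q`. -/
def collapse {G : Type*} [Group G] (f₀ : FreeGroup A →* G) (gx : X → G) (N : ℕ) (p q : X) :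
    FreeGroup (A ⊕ X ⊕ ZMod (2 * N + 1)) →* G :=
  FreeGroup.lift (Sum.elim (fun a => f₀ (FreeGroup.of a))
    (Sum.elim gx fun z => if z.val < N then gx p else gx q))

lemma intCast_inj {i j : ℤ} (h : |i - j| ≤ 2 * N)
    (hij : (i : ZMod (2 * N + 1)) = (j : ZMod (2 * N + 1))) : i = j := by
  rw [ZMod.intCast_eq_intCast_iff_dvd_sub] at hij
  have := Int.eq_zero_of_abs_lt_dvd hij (by rw [abs_sub_comm]; push_cast; omega)
  omega

lemma cyc_mem_without {i j : ℤ} (h : |i - j| ≤ 2 * N) (hij : i ≠ j) :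
    cyc A X N i ∈ without (Sum.inr (Sum.inr (j : ZMod (2 * N + 1)))) :=
  of_mem_without fun e => hij (intCast_inj h (by simpa using e))

lemma const_mem_without (x : X) (z : ZMod (2 * N + 1)) :
    const A N x ∈ without (Sum.inr (Sum.inr z)) :=
  of_mem_without (by simp)

lemma incl_mem_without (u : FreeGroup A) (z : ZMod (2 * N + 1)) :
    incl A X N u ∈ without (Sum.inr (Sum.inr z)) := by
  induction u using FreeGroup.induction_on with
  | C1 => rw [map_one]; exact one_mem _
  | of a => exact of_mem_without (by simp)
  | inv_of a h => rw [map_inv]; exact inv_mem h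
  | mul a b ha hb => rw [map_mul]; exact mul_mem ha hb

section Collapse
variable {G : Type*} [Group G] (f₀ : FreeGroup A →* G) (gx : X → G) (p q : X)

lemma collapse_incl : (collapse f₀ gx N p q).comp (incl A X N) = f₀ := by
  ext a
  simp [collapse, incl]

@[simp] lemma collapse_const (x : X) : collapse f₀ gx N p q (const A N x) = gx x := by
  simp [collapse, const]

lemma val_intCast {i : ℤ} (h0 : 0 ≤ i) (h1 : i ≤ 2 * N) :
    (((i : ZMod (2 * N + 1))).val : ℤ) = i := by
  rw [ZMod.val_intCast, Int.emod_eq_of_lt h0]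
  push_cast
  omega

lemma collapse_cyc_of_lt {i : ℤ} (h0 : 0 ≤ i) (h1 : i < N) :
    collapse f₀ gx N p q (cyc A X N i) = gx p := by
  have := val_intCast (N := N) h0 (by omega)
  simp only [collapse, cyc, FreeGroup.lift_apply_of, Sum.elim_inr]
  rw [if_pos (by omega)]

lemma collapse_cyc_of_ge {i : ℤ} (h0 : N ≤ i) (h1 : i ≤ 2 * N) :
    collapse f₀ gx N p q (cyc A X N i) = gx q := by
  have := val_intCast (N := N) (i := i) (by omega) (by omega)
  simp only [collapse, cyc, FreeGroup.lift_apply_of, Sum.elim_inr]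
  rw [if_neg (by omega)]

end Collapse

/-- The shift automorphism determined by a word that involves the `N`-th cyclic generator
exactly once. -/
lemma exists_shift (hN : 1 ≤ N) (p q : X) {w : FreeGroup (A ⊕ X ⊕ ZMod (2 * N + 1))}
    (hw : LinearIn (Sum.inr (Sum.inr ((N : ℤ) : ZMod (2 * N + 1)))) w) :
    ∃ σ : MulAut (FreeGroup (A ⊕ X ⊕ ZMod (2 * N + 1))),
      (∀ u, σ (incl A X N u) = incl A X N u) ∧ (∀ x, σ (const A N x) = const A N x) ∧
      (∀ i : ℤ, 0 ≤ i → i < 2 * N → i + 1 ≠ N → σ (cyc A X N i) = cyc A X N (i + 1)) ∧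
      σ (cyc A X N (N - 1)) = w ∧
      σ (cyc A X N (2 * N)) = const A N q * (const A N p)⁻¹ * cyc A X N 0 := by
  obtain ⟨T, hT, hT'⟩ := hw.exists_mulAut
  obtain ⟨T₀, hT₀, hT₀'⟩ := (((linearIn_of (Sum.inr (Sum.inr (0 : ZMod (2 * N + 1))))).mul_left
    (inv_mem (const_mem_without (A := A) p 0))).mul_left (const_mem_without q 0)).exists_mulAut
  let π : MulAut (FreeGroup (A ⊕ X ⊕ ZMod (2 * N + 1))) := FreeGroup.freeGroupCongr
    ((Equiv.refl A).sumCongr ((Equiv.refl X).sumCongr (Equiv.addRight 1)))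
  have hcyc : ∀ i : ℤ, π (cyc A X N i) = cyc A X N (i + 1) := fun i => by simp [π, cyc]
  have hT₀c : ∀ i : ℤ, 0 < i → i ≤ 2 * N → T₀ (cyc A X N i) = cyc A X N i := fun i h0 h1 =>
    hT₀' _ fun e => h0.ne' (intCast_inj (N := N) (by rw [abs_le]; omega) (by simpa using e))
  have hTc : ∀ i : ℤ, 0 ≤ i → i ≤ 2 * N → i ≠ N → T (cyc A X N i) = cyc A X N i :=
    fun i h0 h1 h2 => hT' _ fun e =>
      h2 (intCast_inj (N := N) (by rw [abs_le]; omega) (by simpa using e))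
  have hTx : ∀ x, T (const A N x) = const A N x := fun x => hT' _ (by simp)
  refine ⟨T * T₀ * π, fun u => ?_, fun x => ?_, fun i h0 h1 h2 => ?_, ?_, ?_⟩
  · simp only [MulAut.mul_apply]
    have hπ : π.toMonoidHom.comp (incl A X N) = incl A X N := by
      ext a
      simp [π, incl]
    rw [show π (incl A X N u) = incl A X N u from DFunLike.congr_fun hπ u,
      show T₀ (incl A X N u) = incl A X N u from
        map_eq_of_mem_without (f := T₀.toMonoidHom) hT₀' (incl_mem_without u 0)]
    exact map_eq_of_mem_without (f := T.toMonoidHom) hT' (incl_mem_without u _)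
  · simp only [MulAut.mul_apply]
    rw [show π (const A N x) = const A N x by simp [π, const],
      show T₀ (const A N x) = const A N x from hT₀' _ (by simp), hTx]
  · simp only [MulAut.mul_apply]
    rw [hcyc, hT₀c _ (by omega) (by omega), hTc _ (by omega) (by omega) h2]
  · simp only [MulAut.mul_apply]
    rw [hcyc, sub_add_cancel, hT₀c _ (by omega) (by omega)]
    exact hT
  · simp only [MulAut.mul_apply]
    have h0 : cyc A X N (2 * N + 1) = FreeGroup.of (Sum.inr (Sum.inr 0)) := by
      have : ((2 * N + 1 : ℕ) : ZMod (2 * N + 1)) = 0 := ZMod.natCast_self _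
      push_cast at this
      simp [cyc, this]
    rw [hcyc, h0, hT₀, map_mul, map_mul, map_inv, hTx, hTx, mul_assoc]
    congr 2
    simpa [cyc] using hTc 0 le_rfl (by omega) (by omega)

lemma collapse_shift {G : Type*} [Group G] (f₀ : FreeGroup A →* G) (gx : X → G) (hN : 1 ≤ N)
    (p q : X) {w : FreeGroup (A ⊕ X ⊕ ZMod (2 * N + 1))}
    (hw : collapse f₀ gx N p q w = gx p) {σ : MulAut (FreeGroup (A ⊕ X ⊕ ZMod (2 * N + 1)))}
    (hι : ∀ u, σ (incl A X N u) = incl A X N u) (hc : ∀ x, σ (const A N x) = const A N x)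
    (hσ : ∀ i : ℤ, 0 ≤ i → i < 2 * N → i + 1 ≠ N → σ (cyc A X N i) = cyc A X N (i + 1))
    (hσw : σ (cyc A X N (N - 1)) = w)
    (hσq : σ (cyc A X N (2 * N)) = const A N q * (const A N p)⁻¹ * cyc A X N 0)
    (v : FreeGroup (A ⊕ X ⊕ ZMod (2 * N + 1))) :
    collapse f₀ gx N p q (σ v) = collapse f₀ gx N p q v := by
  suffices (collapse f₀ gx N p q).comp σ.toMonoidHom = collapse f₀ gx N p q from
    DFunLike.congr_fun this v
  ext s
  change collapse f₀ gx N p q (σ (FreeGroup.of s)) = collapse f₀ gx N p q (FreeGroup.of s)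
  rcases s with a | x | z
  · congr 1
    simpa [incl] using hι (FreeGroup.of a)
  · exact congrArg _ (hc x)
  · obtain ⟨n, hn, rfl⟩ : ∃ n : ℤ, (0 ≤ n ∧ n ≤ 2 * N) ∧ (n : ZMod (2 * N + 1)) = z :=
      ⟨z.val, by have := z.val_lt; omega, by simp⟩
    change collapse f₀ gx N p q (σ (cyc A X N n)) = collapse f₀ gx N p q (cyc A X N n)
    by_cases h1 : n = N - 1
    · rw [collapse_cyc_of_lt _ _ _ _ (by omega) (by omega), h1, hσw, hw]
    by_cases h2 : n = 2 * N
    · rw [collapse_cyc_of_ge _ _ _ _ (by omega) (by omega), h2, hσq]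
      simp [collapse_cyc_of_lt f₀ gx p q (N := N) (i := 0) le_rfl (by omega)]
    rw [hσ n (by omega) (by omega) (by omega)]
    rcases lt_or_ge n N with h3 | h3
    · rw [collapse_cyc_of_lt _ _ _ _ (by omega) (by omega),
        collapse_cyc_of_lt _ _ _ _ (by omega) (by omega)]
    · rw [collapse_cyc_of_ge _ _ _ _ (by omega) (by omega),
        collapse_cyc_of_ge _ _ _ _ (by omega) (by omega)]

lemma list_prod_split {M : Type*} [Monoid M] {v v' : List M} (hlen : v.length = v'.length)
    (k : ℕ) (hk : k < v.length)
    (h : ∀ (j : ℕ) (hj : j < v.length), j ≠ k → v[j] = v'[j]) :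
    v.prod = (v'.take k).prod * v[k] * (v'.drop (k + 1)).prod := by
  have h1 : v.take k = v'.take k := by
    refine List.ext_getElem (by simp [hlen]) fun j hj _ => ?_
    simp only [List.length_take, lt_inf_iff] at hj
    simpa using h j hj.2 hj.1.ne
  have h2 : v.drop (k + 1) = v'.drop (k + 1) := by
    refine List.ext_getElem (by simp [hlen]) fun j hj _ => ?_
    simp only [List.length_drop] at hj
    simpa using h (k + 1 + j) (by omega) (by omega)
  rw [← h1, ← h2, mul_assoc, ← List.prod_cons, List.getElem_cons_drop, List.prod_take_mul_prod_drop]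

lemma linearIn_drop_mul_take {S : Type*} {i : S} {w : List (FreeGroup S)} {k l : ℕ}
    (hl : l < w.length) (hkl : l ≠ k) (hlin : LinearIn i w[l])
    (h : ∀ (j : ℕ) (hj : j < w.length), j ≠ k → j ≠ l → w[j] ∈ without i) :
    LinearIn i ((w.drop (k + 1)).prod * (w.take k).prod) := by
  rcases lt_or_gt_of_ne hkl with hlt | hgt
  · refine LinearIn.mul_left (LinearIn.list_prod _ l (by simp; omega) (by simpa using hlin) ?_)
      (Subgroup.list_prod_mem _ fun x hx => ?_)
    · intro j hj hjl
      simp only [List.length_take, lt_inf_iff] at hj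
      simpa using h j hj.2 hj.1.ne hjl
    · obtain ⟨j, hj, rfl⟩ := List.getElem_of_mem hx
      simp only [List.length_drop] at hj
      simpa using h (k + 1 + j) (by omega) (by omega) (by omega)
  · refine LinearIn.mul_right (LinearIn.list_prod _ (l - (k + 1)) (by simp; omega) ?_ ?_)
      (Subgroup.list_prod_mem _ fun x hx => ?_)
    · simpa [Nat.add_sub_cancel' (show k + 1 ≤ l from hgt)] using hlin
    · intro j hj hjl
      simp only [List.length_drop] at hj
      simpa using h (k + 1 + j) (by omega) (by omega) (by omega)
    · obtain ⟨j, hj, rfl⟩ := List.getElem_of_mem hx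
      simp only [List.length_take, lt_inf_iff] at hj
      simpa using h j hj.2 hj.1.ne (by omega)

/-- A decorated relator in which `p` has a unique highest occurrence and `q` a unique lowest one
can be solved in a finitely generated free group with a shift automorphism. -/
lemma exists_solution {G : Type*} [Group G] (f₀ : FreeGroup A →* G) (gx : X → G)
    (T : List (X × ℤ × Bool × FreeGroup A)) (hN : 1 ≤ N) {k l : ℕ} (hk : k < T.length)
    (hl : l < T.length) (hne : T[k].1 ≠ T[l].1)
    (hmax : ∀ (j : ℕ) (hj : j < T.length), j ≠ k → T[j].1 = T[k].1 →
      T[k].2.1 - N ≤ T[j].2.1 ∧ T[j].2.1 < T[k].2.1)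
    (hmin : ∀ (j : ℕ) (hj : j < T.length), j ≠ l → T[j].1 = T[l].1 →
      T[l].2.1 < T[j].2.1 ∧ T[j].2.1 ≤ T[l].2.1 + N)
    (hG : (T.map (evalEdge f₀ fun x _ => gx x)).prod = 1) :
    ∃ (σ : MulAut (FreeGroup (A ⊕ X ⊕ ZMod (2 * N + 1))))
      (y : X → FreeGroup (A ⊕ X ⊕ ZMod (2 * N + 1)))
      (f : FreeGroup (A ⊕ X ⊕ ZMod (2 * N + 1)) →* G),
      (∀ u, σ (incl A X N u) = incl A X N u) ∧ (∀ w, f (σ w) = f w) ∧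
      f.comp (incl A X N) = f₀ ∧ (∀ x, f (y x) = gx x) ∧
      (T.map (evalEdge (incl A X N) fun x g => (σ ^ g) (y x))).prod = 1 := by
  classical
  set p := T[k].1 with hp
  set q := T[l].1 with hq
  set β := T[k].2.1 with hβ
  set α := T[l].2.1 with hα
  have hlk : l ≠ k := by rintro rfl; exact hne rfl
  let Y : X → ℤ → FreeGroup (A ⊕ X ⊕ ZMod (2 * N + 1)) := fun x g =>
    if x = p then cyc A X N (g - β + N) else if x = q then cyc A X N (N + (g - α))
    else const A N x
  let w := T.map (evalEdge (incl A X N) Y)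
  have hwlen : w.length = T.length := by simp [w]
  have hmem : ∀ (j : ℕ) (hj : j < w.length), j ≠ k → j ≠ l →
      w[j] ∈ without (Sum.inr (Sum.inr ((N : ℤ) : ZMod (2 * N + 1)))) := by
    intro j hj hjk hjl
    have hj' : j < T.length := by omega
    simp only [w, List.getElem_map, evalEdge]
    refine mul_mem (signed_mem _ ?_) (incl_mem_without _ _)
    simp only [Y]
    split_ifs with h1 h2
    · have := hmax j hj' hjk h1
      exact cyc_mem_without (by rw [abs_le]; omega) (by omega)
    · have := hmin j hj' hjl h2
      exact cyc_mem_without (by rw [abs_le]; omega) (by omega)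
    · exact const_mem_without _ _
  have hlin : LinearIn (Sum.inr (Sum.inr ((N : ℤ) : ZMod (2 * N + 1)))) w[l] := by
    simp only [w, List.getElem_map, evalEdge]
    refine LinearIn.mul_right (LinearIn.apply_signed ?_ _) (incl_mem_without _ _)
    simp only [Y]
    rw [if_neg hne.symm, if_pos rfl, hα, sub_self, add_zero]
    exact linearIn_of _
  set U := (w.take k).prod with hU
  set D := (w.drop (k + 1)).prod with hD
  set h := incl A X N T[k].2.2.2 with hh
  set ε := T[k].2.2.1 with hε
  let v := signed ε (h * (D * U))⁻¹
  have hv : LinearIn (Sum.inr (Sum.inr ((N : ℤ) : ZMod (2 * N + 1)))) v :=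
    (((linearIn_drop_mul_take (by omega) hlk hlin hmem).mul_left
      (incl_mem_without _ _)).inv).apply_signed _
  have hfY : ∀ (j : ℕ) (hj : j < T.length), j ≠ k →
      collapse f₀ gx N p q (Y T[j].1 T[j].2.1) = gx T[j].1 := by
    intro j hj hjk
    simp only [Y]
    split_ifs with h1 h2
    · have := hmax j hj hjk h1
      rw [collapse_cyc_of_lt _ _ _ _ (by omega) (by omega), h1]
    · have : α ≤ T[j].2.1 ∧ T[j].2.1 ≤ α + N := by
        by_cases hjl : j = l
        · subst hjl; omega
        · have := hmin j hj hjl h2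
          omega
      rw [collapse_cyc_of_ge _ _ _ _ (by omega) (by omega), h2]
    · simp
  have hfv : collapse f₀ gx N p q v = gx p := by
    have := list_prod_split (v := T.map (evalEdge f₀ fun x _ => gx x))
      (v' := w.map (collapse f₀ gx N p q)) (by simp [w]) k (by simpa using hk) (by
        intro j hj hjk
        have hj' : j < T.length := by simpa using hj
        simp only [w, List.getElem_map, map_evalEdge, collapse_incl]
        simp only [evalEdge, hfY j hj' hjk])
    rw [hG, ← List.map_take, ← List.map_drop, ← map_list_prod, ← map_list_prod, ← hU, ← hD,
      List.getElem_map, evalEdge, ← hε, ← hp] at this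
    have h2 : collapse f₀ gx N p q h = f₀ T[k].2.2.2 :=
      DFunLike.congr_fun (collapse_incl f₀ gx p q) _
    rw [← h2] at this
    have h3 : signed ε (gx p) = collapse f₀ gx N p q (h * (D * U))⁻¹ := by
      simp only [map_inv, map_mul]
      rw [eq_inv_iff_mul_eq_one]
      have h4 := congrArg (fun g => (collapse f₀ gx N p q U)⁻¹⁻¹⁻¹ * g *
        collapse f₀ gx N p q U) this
      simp only [inv_inv, mul_one, inv_mul_cancel] at h4
      rw [h4]
      group
    simp only [v]
    rw [map_signed, ← h3, signed_signed]
  obtain ⟨σ, hσι, hσc, hσ, hσv, hσq⟩ := exists_shift hN p q hv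
  have hfσ := collapse_shift f₀ gx hN p q hfv hσι hσc hσ hσv hσq
  have hpowp : ∀ n : ℕ, n < N → (σ ^ (n : ℤ)) (cyc A X N 0) = cyc A X N n := by
    intro n hn
    induction n with
    | zero => simp
    | succ n ih =>
      rw [zpow_natCast_succ_apply, ih (by omega), hσ _ (by omega) (by omega) (by omega),
        Nat.cast_succ]
  have hpowv : (σ ^ (N : ℤ)) (cyc A X N 0) = v := by
    have := zpow_natCast_succ_apply σ (N - 1) (cyc A X N 0)
    rwa [Nat.sub_add_cancel hN, hpowp (N - 1) (by omega), Nat.cast_pred hN, hσv] at this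
  have hpowq : ∀ n : ℕ, n ≤ N → (σ ^ (n : ℤ)) (cyc A X N N) = cyc A X N (N + n) := by
    intro n hn
    induction n with
    | zero => simp
    | succ n ih =>
      rw [zpow_natCast_succ_apply, ih (by omega), hσ _ (by omega) (by omega) (by omega),
        Nat.cast_succ, add_assoc]
  let y : X → FreeGroup (A ⊕ X ⊕ ZMod (2 * N + 1)) := fun x =>
    if x = p then (σ ^ (N - β)) (cyc A X N 0) else if x = q then (σ ^ (-α)) (cyc A X N N)
    else const A N x
  have hy : ∀ (j : ℕ) (hj : j < T.length), j ≠ k →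
      (σ ^ T[j].2.1) (y T[j].1) = Y T[j].1 T[j].2.1 := by
    intro j hj hjk
    simp only [y, Y]
    split_ifs with h1 h2
    · have := hmax j hj hjk h1
      obtain ⟨n, hn⟩ := Int.eq_ofNat_of_zero_le (show 0 ≤ T[j].2.1 - β + N by omega)
      rw [← MulAut.mul_apply, ← zpow_add, hn, ← hpowp n (by omega)]
      congr 2
      omega
    · have : α ≤ T[j].2.1 ∧ T[j].2.1 ≤ α + N := by
        by_cases hjl : j = l
        · subst hjl; omega
        · have := hmin j hj hjl h2
          omega
      obtain ⟨n, hn⟩ := Int.eq_ofNat_of_zero_le (show 0 ≤ T[j].2.1 - α by omega)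
      rw [← MulAut.mul_apply, ← zpow_add, hn, ← hpowq n (by omega)]
      congr 2
    · exact zpow_apply_of_fixed (hσc _) _
  have hyk : (σ ^ β) (y p) = v := by
    simp only [y, if_true]
    rw [← MulAut.mul_apply, ← zpow_add, ← hpowv]
    congr 2
    omega
  refine ⟨σ, y, collapse f₀ gx N p q, hσι, hfσ, collapse_incl f₀ gx p q, fun x => ?_, ?_⟩
  · simp only [y]
    split_ifs with h1 h2
    · rw [map_zpow_apply hfσ, collapse_cyc_of_lt _ _ _ _ le_rfl (by omega), h1]
    · rw [map_zpow_apply hfσ, collapse_cyc_of_ge _ _ _ _ le_rfl (by omega), h2]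
    · simp
  · rw [list_prod_split (v' := w) (by simp [w]) k (by simpa using hk) (by
      intro j hj hjk
      have hj' : j < T.length := by simpa using hj
      simp only [w, List.getElem_map, evalEdge, hy j hj' hjk])]
    rw [List.getElem_map, evalEdge, ← hp, ← hβ, ← hε, ← hh, hyk, ← hU, ← hD]
    simp only [v, signed_signed]
    group

end Construction

end UniqueMaxMin

/-- (From Remarks 2 and 4, used in the proof of Theorem 5.) Let `Φ` be a
finitely generated free group, `x` a finite set, and `P = ⟨x, Φ; R⟩` an
`M_Φ`-presentation. Then `G = G(P)` is a retract of a group of the form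
`L ⋊ ℤ` with `L` a finitely generated free group. -/
theorem retract_of_fg_free_by_cyclic {A X : Type*} [Finite A] [Finite X]
    (R : List (X × Bool × FreeGroup A)) (hP : HasUniqueMaxMin (skel R)) :
    ∃ (n : ℕ) (φ : Multiplicative ℤ →* MulAut (FreeGroup (Fin n)))
      (μ : relGroup R →* FreeGroup (Fin n) ⋊[φ] Multiplicative ℤ)
      (ρ : FreeGroup (Fin n) ⋊[φ] Multiplicative ℤ →* relGroup R),
      ρ.comp μ = MonoidHom.id (relGroup R) := by
  obtain ⟨θ, hθ⟩ := hP
  obtain ⟨k, l, hne, hmax, hmin⟩ := UniqueMaxMin.exists_extremal hθ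
  obtain ⟨N, hN, hNk, hNl⟩ : ∃ N : ℕ, 1 ≤ N ∧
      (∀ j, |UniqueMaxMin.source θ (skel R) j - UniqueMaxMin.source θ (skel R) k| ≤ N) ∧
      (∀ j, |UniqueMaxMin.source θ (skel R) j - UniqueMaxMin.source θ (skel R) l| ≤ N) := by
    let b : Fin (skel R).length → ℕ := fun j =>
      (UniqueMaxMin.source θ (skel R) j - UniqueMaxMin.source θ (skel R) k).natAbs +
        (UniqueMaxMin.source θ (skel R) j - UniqueMaxMin.source θ (skel R) l).natAbs
    have hb : ∀ j, b j ≤ ∑ i, b i := fun j =>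
      Finset.single_le_sum (fun i _ => Nat.zero_le (b i)) (Finset.mem_univ j)
    refine ⟨1 + ∑ i, b i, by omega, fun j => ?_, fun j => ?_⟩ <;>
    · have := hb j
      simp only [b] at this ⊢
      rw [abs_le]
      omega
  have hlen : (UniqueMaxMin.annotate θ 0 R).length = (skel R).length := by simp [skel]
  have hann := fun (j : ℕ) (hj : j < (UniqueMaxMin.annotate θ 0 R).length) =>
    UniqueMaxMin.getElem_annotate θ 0 R j hj (hlen ▸ hj)
  obtain ⟨hk1, hk2⟩ := hann k (k.2.trans_eq hlen.symm)
  obtain ⟨hl1, hl2⟩ := hann l (l.2.trans_eq hlen.symm)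
  have hrel : ((UniqueMaxMin.annotate θ 0 R).map (UniqueMaxMin.evalEdge (natHom R) fun x _ =>
      QuotientGroup.mk' (Subgroup.normalClosure {relWord R})
        (Coprod.inr (FreeGroup.of x)))).prod = 1 := by
    exact (congrArg List.prod (UniqueMaxMin.map_evalEdge_annotate (natHom R) _ θ 0 R)).trans
      ((UniqueMaxMin.map_relWord _ R).symm.trans (UniqueMaxMin.mk_relWord R))
  obtain ⟨σ, y, f, hσι, hfσ, hfι, hfy, hR⟩ := UniqueMaxMin.exists_solution (natHom R) _
    (UniqueMaxMin.annotate θ 0 R) hN (k.2.trans_eq hlen.symm) (l.2.trans_eq hlen.symm)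
    (by rw [hk1, hl1]; exact hne)
    (by
      intro j hj hjk hx
      obtain ⟨hj1, hj2⟩ := hann j hj
      rw [hj1, hk1] at hx
      have h1 := hmax ⟨j, hlen ▸ hj⟩ (fun h => hjk (congrArg Fin.val h)) hx
      have h2 := abs_le.1 (hNk ⟨j, hlen ▸ hj⟩)
      rw [hj2, hk2]
      simp only [Fin.eta]
      omega)
    (by
      intro j hj hjl hx
      obtain ⟨hj1, hj2⟩ := hann j hj
      rw [hj1, hl1] at hx
      have h1 := hmin ⟨j, hlen ▸ hj⟩ (fun h => hjl (congrArg Fin.val h)) hx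
      have h2 := abs_le.1 (hNl ⟨j, hlen ▸ hj⟩)
      rw [hj2, hl2]
      simp only [Fin.eta]
      omega)
    hrel
  obtain ⟨μ, ρ, h⟩ := UniqueMaxMin.exists_retract R θ hθ.2.2.2.1 σ (UniqueMaxMin.incl A X N) hσι
    y f hfσ hfι hfy hR
  let e := FreeGroup.freeGroupCongr (Finite.equivFin (A ⊕ X ⊕ ZMod (2 * N + 1)))
  let E := SemidirectProduct.congr' (φ₁ := zpowersHom _ σ) e (MulEquiv.refl (Multiplicative ℤ))
  refine ⟨_, _, E.toMonoidHom.comp μ, ρ.comp E.symm.toMonoidHom, ?_⟩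
  rw [← h]
  ext g
  change ρ (E.symm (E (μ g))) = ρ (μ g)
  rw [E.symm_apply_apply]
end

section
/- Let H be a group and P = ⟨x, H; R⟩ a relative one-relator presentation whose x-skeleton W has the unique min property with respect to an admissible strict weight function, and let G = G(P). Then every finite subgroup of G is contained in a conjugate of the image ν(H) of the natural homomorphism ν : H → G. -/
open Monoid

/-- `W` has the unique min property with respect to `θ`: `θ` is an admissible
strict weight function for `W`, the graph of `W` has a unique minimum at `l`,
and `W` is reduced at the minimum (`x_l ≠ x_{l+1}`, subscripts mod `r`). -/
def UniqueMinWith {X : Type*} (θ : X → ℤ) (W : List (X × Bool)) : Prop :=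
  W ≠ [] ∧ IsWeightFun θ ∧ IsStrictWeight θ ∧ IsAdmissible θ W ∧
  ∃ l : Fin W.length,
    (∀ j : Fin W.length, j ≠ l → phiW θ W (l.1 + 1) < phiW θ W (j.1 + 1)) ∧
    (W.get l).1 ≠ (W.get (succIdx W l)).1

/-- `W` has the unique min property with respect to some admissible strict
weight function. -/
def HasUniqueMin {X : Type*} (W : List (X × Bool)) : Prop :=
  ∃ θ : X → ℤ, UniqueMinWith θ W


namespace Monoid.CoprodI

variable {ι : Type*} {G : ι → Type*} [∀ i, Group (G i)]

theorem NeWord.prod_ne_one {i j : ι} (w : NeWord G i j) : w.prod ≠ 1 := by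
  classical
  intro h
  have : w.toWord = Word.empty := by
    apply Word.equiv.symm.injective
    exact h.trans Word.prod_empty.symm
  exact w.toList_ne_nil (congrArg Word.toList this)

/-- A reduced word whose first and last letters lie in different factors has infinite order. -/
theorem NeWord.not_isOfFinOrder {i j : ι} (w : NeWord G i j) (hij : i ≠ j) :
    ¬ IsOfFinOrder w.prod := by
  have key : ∀ n : ℕ, ∃ v : NeWord G i j, v.prod = w.prod ^ (n + 1) := by
    intro n
    induction n with
    | zero => exact ⟨w, by simp⟩
    | succ n ih =>
      obtain ⟨v, hv⟩ := ih
      exact ⟨v.append hij.symm w, by rw [append_prod, hv, ← pow_succ]⟩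
  rw [isOfFinOrder_iff_pow_eq_one]
  rintro ⟨n, hn, h⟩
  obtain ⟨v, hv⟩ := key (n - 1)
  rw [Nat.sub_add_cancel hn, h] at hv
  exact v.prod_ne_one hv

/-- A reduced word is a single letter, or its first letter can be split off. -/
theorem NeWord.exists_eq_of_mul {i j : ι} (w : NeWord G i j) :
    (i = j ∧ ∃ x : G i, x ≠ 1 ∧ w.prod = of x) ∨
      ∃ x : G i, x ≠ 1 ∧ ∃ k, i ≠ k ∧ ∃ v : NeWord G k j,
        w.prod = of x * v.prod ∧ v.toList.length < w.toList.length := by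
  induction w with
  | singleton x hx => exact .inl ⟨rfl, x, hx, by simp⟩
  | append w₁ hne w₂ ih₁ _ =>
    right
    rcases ih₁ with ⟨rfl, x, hx, h⟩ | ⟨x, hx, k, hk, v, hv, hlt⟩
    · refine ⟨x, hx, _, hne, w₂, by rw [append_prod, h], ?_⟩
      have := List.length_pos_of_ne_nil w₁.toList_ne_nil
      simp only [toList, List.length_append]
      omega
    · refine ⟨x, hx, k, hk, v.append hne w₂, by rw [append_prod, append_prod, hv, mul_assoc], ?_⟩
      simp only [toList, List.length_append]
      omega

/-- A reduced word is a single letter, or its last letter can be split off. -/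
theorem NeWord.exists_eq_mul_of {i j : ι} (w : NeWord G i j) :
    (i = j ∧ ∃ x : G j, x ≠ 1 ∧ w.prod = of x) ∨
      ∃ x : G j, x ≠ 1 ∧ ∃ k, k ≠ j ∧ ∃ v : NeWord G i k,
        w.prod = v.prod * of x ∧ v.toList.length < w.toList.length := by
  induction w with
  | singleton x hx => exact .inl ⟨rfl, x, hx, by simp⟩
  | append w₁ hne w₂ _ ih₂ =>
    right
    rcases ih₂ with ⟨rfl, x, hx, h⟩ | ⟨x, hx, k, hk, v, hv, hlt⟩
    · refine ⟨x, hx, _, hne, w₁, by rw [append_prod, h], ?_⟩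
      have := List.length_pos_of_ne_nil w₂.toList_ne_nil
      simp only [toList, List.length_append]
      omega
    · refine ⟨x, hx, k, hk, w₁.append hne v, by rw [append_prod, append_prod, hv, mul_assoc], ?_⟩
      simp only [toList, List.length_append]
      omega

theorem _root_.isOfFinOrder_conj {Γ : Type*} [Group Γ] {g : Γ} (h : IsOfFinOrder g) (a : Γ) :
    IsOfFinOrder (a * g * a⁻¹) :=
  (MulAut.conj a).toMonoidHom.isOfFinOrder h

/-- A reduced word of finite order is a single letter or a conjugate of a shorter reduced word by
a letter from a factor different from those of both ends of the shorter word. -/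
theorem NeWord.eq_of_or_eq_conj_of_isOfFinOrder {i j : ι} (w : NeWord G i j)
    (hw : IsOfFinOrder w.prod) :
    (∃ x : G i, x ≠ 1 ∧ w.prod = of x) ∨
      ∃ x : G i, x ≠ 1 ∧ ∃ k l, i ≠ k ∧ l ≠ i ∧ ∃ v : NeWord G k l,
        w.prod = of x * v.prod * (of x)⁻¹ ∧ v.toList.length < w.toList.length := by
  obtain rfl : i = j := by_contra fun h => w.not_isOfFinOrder h hw
  rcases w.exists_eq_of_mul with ⟨-, h⟩ | ⟨x, hx, k, hk, v, hv, hlt⟩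
  · exact .inl h
  · rcases v.exists_eq_mul_of with ⟨h, -⟩ | ⟨z, hz, l, hl, u, hu, hlt'⟩
    · exact absurd h.symm hk
    · refine .inr ⟨x, hx, k, l, hk, hl, u, ?_, hlt'.trans hlt⟩
      by_cases hzx : z * x = 1
      · rw [hv, hu, ← map_inv, eq_inv_of_mul_eq_one_left hzx, mul_assoc]
      · refine absurd ?_ ((u.append hl (.singleton _ hzx)).not_isOfFinOrder hk.symm)
        refine Eq.mpr (congrArg IsOfFinOrder ?_) (isOfFinOrder_conj hw (of x)⁻¹)
        rw [append_prod, prod_singleton, hv, hu, map_mul]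
        group

/-- A torsion subgroup of a free product containing a nontrivial element of a factor is contained
in that factor. -/
theorem mem_range_of_of_isOfFinOrder {S : Subgroup (CoprodI G)} (hS : ∀ s ∈ S, IsOfFinOrder s)
    {i : ι} {x : G i} (hx : x ≠ 1) (hxS : of x ∈ S) {t : CoprodI G} (ht : t ∈ S) :
    t ∈ (of : G i →* CoprodI G).range := by
  classical
  by_cases h1 : t = 1
  · exact h1 ▸ one_mem _
  obtain ⟨j, j', w, hw⟩ := NeWord.of_word (Word.equiv t) fun h =>
    h1 (Word.equiv.injective (h.trans (Word.equiv.apply_symm_apply Word.empty).symm))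
  have hwt : w.prod = t := by
    rw [NeWord.prod, hw]
    exact Word.equiv.symm_apply_apply t
  have hxt := hS _ (mul_mem hxS ht)
  rcases w.eq_of_or_eq_conj_of_isOfFinOrder (hwt ▸ hS t ht) with
    ⟨y, hy, h⟩ | ⟨y, hy, k, l, hk, hl, v, h, -⟩
  · by_cases hij : i = j
    · subst hij
      exact ⟨y, by rw [← hwt, h]⟩
    · refine absurd ?_ ((NeWord.append (.singleton x hx) hij (.singleton y hy)).not_isOfFinOrder hij)
      simpa [← hwt, h] using hxt
  · exfalso
    by_cases hij : i = j
    · subst hij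
      have hyx : y⁻¹ * x * y ≠ 1 := fun hc => hx (by
        simpa using (conj_eq_one_iff (a := y⁻¹) (b := x)).1 (by simpa using hc))
      refine ((NeWord.append (.singleton _ hyx) hk v).not_isOfFinOrder hl.symm) ?_
      refine Eq.mpr (congrArg IsOfFinOrder ?_) (isOfFinOrder_conj hxt (of y)⁻¹)
      rw [← hwt, h, NeWord.append_prod, NeWord.prod_singleton, map_mul, map_mul, map_inv]
      group
    · refine ((NeWord.append (.singleton x hx) hij
        (NeWord.append (.singleton y hy) hk
          (NeWord.append v hl (.singleton y⁻¹ (inv_ne_one.2 hy))))).not_isOfFinOrder hij) ?_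
      convert hxt using 1
      simp [← hwt, h, mul_assoc]

theorem exists_conj_mem_range_of_neWord (n : ℕ) (S : Subgroup (CoprodI G))
    (hS : ∀ s ∈ S, IsOfFinOrder s) {i j : ι} (w : NeWord G i j) (hw : w.prod ∈ S)
    (hn : w.toList.length ≤ n) :
    ∃ (k : ι) (g : CoprodI G), ∀ s ∈ S, g * s * g⁻¹ ∈ (of : G k →* CoprodI G).range := by
  induction n generalizing S i j with
  | zero => exact absurd (List.length_eq_zero_iff.1 (Nat.le_zero.1 hn)) w.toList_ne_nil
  | succ n ih =>
    rcases w.eq_of_or_eq_conj_of_isOfFinOrder (hS _ hw) with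
      ⟨y, hy, h⟩ | ⟨y, hy, k, l, hk, hl, v, h, hlt⟩
    · refine ⟨i, 1, fun s hs => ?_⟩
      simpa using mem_range_of_of_isOfFinOrder hS hy (h ▸ hw) hs
    · obtain ⟨m, g, hg⟩ := ih (S.comap (MulAut.conj (of y)).toMonoidHom) (fun s hs => by
          simpa [mul_assoc] using isOfFinOrder_conj (hS _ (Subgroup.mem_comap.1 hs)) (of y)⁻¹) v
        (by simpa [← h] using hw) (by omega)
      refine ⟨m, g * (of y)⁻¹, fun s hs => ?_⟩
      have := hg ((of y)⁻¹ * s * of y) (by simpa [mul_assoc] using hs)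
      simpa [mul_assoc] using this

/-- Every torsion subgroup of a free product is contained in a conjugate of a factor. -/
theorem exists_conj_mem_range_of [Nonempty ι] (S : Subgroup (CoprodI G))
    (hS : ∀ s ∈ S, IsOfFinOrder s) :
    ∃ (k : ι) (g : CoprodI G), ∀ s ∈ S, g * s * g⁻¹ ∈ (of : G k →* CoprodI G).range := by
  classical
  by_cases h : ∃ s ∈ S, s ≠ 1
  · obtain ⟨s, hs, h1⟩ := h
    obtain ⟨i, j, w, hw⟩ := NeWord.of_word (Word.equiv s) fun h =>
      h1 (Word.equiv.injective (h.trans (Word.equiv.apply_symm_apply Word.empty).symm))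
    have hws : w.prod = s := by
      rw [NeWord.prod, hw]
      exact Word.equiv.symm_apply_apply s
    exact exists_conj_mem_range_of_neWord _ S hS w (hws ▸ hs) le_rfl
  · push Not at h
    exact ⟨Classical.arbitrary ι, 1, fun s hs => by simp [h s hs]⟩

end Monoid.CoprodI

/-- Every torsion subgroup of a free product of a group and a free group is contained in a
conjugate of the first factor. -/
theorem Monoid.Coprod.exists_conj_mem_range_inl {H X : Type*} [Group H]
    (S : Subgroup (Coprod H (FreeGroup X))) (hS : ∀ s ∈ S, IsOfFinOrder s) :
    ∃ g : Coprod H (FreeGroup X), ∀ s ∈ S,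
      g * s * g⁻¹ ∈ (Coprod.inl : H →* Coprod H (FreeGroup X)).range := by
  let emb : Coprod H (FreeGroup X) →* CoprodI (fun _ : Bool => H × FreeGroup X) :=
    Coprod.lift ((CoprodI.of (i := true)).comp (MonoidHom.inl _ _))
      ((CoprodI.of (i := false)).comp (MonoidHom.inr _ _))
  let ret : CoprodI (fun _ : Bool => H × FreeGroup X) →* Coprod H (FreeGroup X) :=
    CoprodI.lift fun b => match b with
      | true => Coprod.inl.comp (MonoidHom.fst _ _)
      | false => Coprod.inr.comp (MonoidHom.snd _ _)
  have hret : ret.comp emb = MonoidHom.id _ := by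
    ext <;> simp [ret, emb]
  replace hret : ∀ s, ret (emb s) = s := fun s => DFunLike.congr_fun hret s
  obtain ⟨k, g, hg⟩ := CoprodI.exists_conj_mem_range_of (S.map emb) (by
    rintro _ ⟨s, hs, rfl⟩
    exact emb.isOfFinOrder (hS s hs))
  refine ⟨ret g, fun s hs => ?_⟩
  obtain ⟨⟨h, f⟩, hx⟩ := hg (emb s) ⟨s, hs, rfl⟩
  replace hx := congrArg ret hx
  simp only [map_mul, map_inv, hret] at hx
  rw [← hx]
  cases k with
  | true => exact ⟨h, by simp [ret]⟩
  | false =>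
    have hf : ret (CoprodI.of (i := false) (h, f)) = Coprod.inr f := by simp [ret]
    have hfin := isOfFinOrder_conj (hS s hs) (ret g)
    rw [← hx, hf, Coprod.inr_injective.isOfFinOrder_iff,
      isOfFinOrder_iff_eq_one] at hfin
    exact ⟨1, by rw [hf, hfin, map_one, map_one]⟩

namespace RelPres

section Weights

variable {X H : Type*}

/-- The weight of a signed letter. -/
def letterWeight (θ : X → ℤ) (p : X × Bool) : ℤ := if p.2 then θ p.1 else -θ p.1

theorem phiW_zero (θ : X → ℤ) (W : List (X × Bool)) : phiW θ W 0 = 0 := by simp [phiW]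

theorem phiW_cons_succ (θ : X → ℤ) (p : X × Bool) (W : List (X × Bool)) (j : ℕ) :
    phiW θ (p :: W) (j + 1) = letterWeight θ p + phiW θ W j := by
  simp [phiW, letterWeight]

theorem phiW_take (θ : X → ℤ) (W : List (X × Bool)) {k l : ℕ} (h : k ≤ l) :
    phiW θ (W.take l) k = phiW θ W k := by
  simp [phiW, List.take_take, min_eq_left h]

theorem phiW_add (θ : X → ℤ) (W : List (X × Bool)) (l k : ℕ) :
    phiW θ W (l + k) = phiW θ W l + phiW θ (W.drop l) k := by
  simp only [phiW]
  rw [List.take_add, List.map_append, List.sum_append]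

theorem phiW_succ (θ : X → ℤ) (W : List (X × Bool)) {k : ℕ} (hk : k < W.length) :
    phiW θ W (k + 1) = phiW θ W k + letterWeight θ W[k] := by
  rw [phiW_add, List.drop_eq_getElem_cons hk, phiW_cons_succ, phiW_zero, add_zero]

theorem skel_cons (t : X × Bool × H) (T : List (X × Bool × H)) :
    skel (t :: T) = (t.1, t.2.1) :: skel T := rfl

end Weights

section Cover

variable (X H : Type*) [Group H]

/-- The free product of copies of `H ∗ F(X)` indexed by the heights `n : ℤ`. -/
abbrev Cover : Type _ := CoprodI (fun _ : ℤ => Coprod H (FreeGroup X))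

/-- The endomorphism of `Cover X H` raising heights by `n`. -/
def shiftHom (n : ℤ) : Cover X H →* Cover X H :=
  CoprodI.lift fun k => CoprodI.of (M := fun _ : ℤ => Coprod H (FreeGroup X)) (i := n + k)

variable {X H}

/-- The copy of the generator `x` at height `n`. -/
def edge (n : ℤ) (x : X) : Cover X H :=
  CoprodI.of (M := fun _ : ℤ => Coprod H (FreeGroup X)) (i := n) (Coprod.inr (FreeGroup.of x))

/-- The copy of `h : H` at height `n`. -/
def vert (n : ℤ) (h : H) : Cover X H :=
  CoprodI.of (M := fun _ : ℤ => Coprod H (FreeGroup X)) (i := n) (Coprod.inl h)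

theorem cover_hom_ext {N : Type*} [Group N] {f g : Cover X H →* N}
    (hv : ∀ n h, f (vert n h) = g (vert n h)) (he : ∀ n x, f (edge n x) = g (edge n x)) :
    f = g := by
  apply CoprodI.ext_hom
  intro n
  ext y
  · exact hv n y
  · exact he n y

@[simp]
theorem shiftHom_edge (n k : ℤ) (x : X) :
    shiftHom X H n (edge k x) = edge (n + k) x := by
  simp [shiftHom, edge]

@[simp]
theorem shiftHom_vert (n k : ℤ) (h : H) :
    shiftHom X H n (vert k h) = vert (n + k) h := by
  simp [shiftHom, vert]

theorem shiftHom_zero : shiftHom X H 0 = MonoidHom.id _ :=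
  cover_hom_ext (by simp) (by simp)

theorem shiftHom_add (m n : ℤ) :
    shiftHom X H (m + n) = (shiftHom X H m).comp (shiftHom X H n) :=
  cover_hom_ext (by simp [add_assoc]) (by simp [add_assoc])

@[simp]
theorem shiftHom_shiftHom (m n : ℤ) (u : Cover X H) :
    shiftHom X H m (shiftHom X H n u) = shiftHom X H (m + n) u := by
  rw [shiftHom_add]; rfl

variable (X H) in
/-- The action of `ℤ` on `Cover X H` by shifting heights. -/
def shift : Multiplicative ℤ →* MulAut (Cover X H) where
  toFun n := MonoidHom.toMulEquiv (shiftHom X H n.toAdd) (shiftHom X H (-n.toAdd))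
    (by rw [← shiftHom_add, neg_add_cancel, shiftHom_zero])
    (by rw [← shiftHom_add, add_neg_cancel, shiftHom_zero])
  map_one' := by
    ext u
    exact DFunLike.congr_fun shiftHom_zero u
  map_mul' m n := by
    ext u
    exact DFunLike.congr_fun (shiftHom_add m.toAdd n.toAdd) u

@[simp]
theorem shift_apply (n : Multiplicative ℤ) (u : Cover X H) :
    shift X H n u = shiftHom X H n.toAdd u := rfl

theorem shiftHom_symm_shift (n : Multiplicative ℤ) (u : Cover X H) :
    shiftHom X H n.toAdd ((shift X H n).symm u) = u :=
  (shift X H n).apply_symm_apply u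

/-- The lift of a word to the path it spells, starting at height `0`, together with its weight. -/
def spell (θ : X → ℤ) : Coprod H (FreeGroup X) →* Cover X H ⋊[shift X H] Multiplicative ℤ :=
  Coprod.lift
    (SemidirectProduct.inl.comp
      ((CoprodI.of (M := fun _ : ℤ => Coprod H (FreeGroup X)) (i := 0)).comp Coprod.inl))
    (FreeGroup.lift fun x => ⟨edge (min 0 (θ x)) x, Multiplicative.ofAdd (θ x)⟩)

theorem spell_inl (θ : X → ℤ) (h : H) : spell θ (Coprod.inl h) = ⟨vert 0 h, 1⟩ := by
  simp only [spell, Coprod.lift_apply_inl]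
  rfl

theorem spell_letter (θ : X → ℤ) (p : X × Bool) :
    spell (H := H) θ (Coprod.inr (FreeGroup.mk [p])) =
      ⟨cond p.2 (edge (min 0 (letterWeight θ p)) p.1) (edge (min 0 (letterWeight θ p)) p.1)⁻¹,
        Multiplicative.ofAdd (letterWeight θ p)⟩ := by
  obtain ⟨x, b⟩ := p
  cases b
  · have hmin : -θ x + min 0 (θ x) = min 0 (-θ x) := by omega
    have hx : (FreeGroup.mk [(x, false)] : FreeGroup X) = (FreeGroup.of x)⁻¹ := rfl
    rw [hx, map_inv, map_inv, spell, Coprod.lift_apply_inr, FreeGroup.lift_apply_of]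
    ext
    · rw [SemidirectProduct.inv_left, shift_apply, map_inv, toAdd_inv, toAdd_ofAdd, shiftHom_edge,
        hmin]
      rfl
    · rfl
  · simp [spell, letterWeight]

theorem relWord_cons (t : X × Bool × H) (T : List (X × Bool × H)) :
    relWord (t :: T) =
      Coprod.inr (FreeGroup.mk [(t.1, t.2.1)]) * Coprod.inl t.2.2 * relWord T := by
  simp [relWord]

theorem relWord_append (S T : List (X × Bool × H)) :
    relWord (S ++ T) = relWord S * relWord T := by
  simp [relWord]

theorem spell_relWord_right (θ : X → ℤ) (T : List (X × Bool × H)) :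
    (spell θ (relWord T)).right = Multiplicative.ofAdd (phiW θ (skel T) T.length) := by
  induction T with
  | nil => simp [relWord, phiW_zero]
  | cons t T ih =>
    rw [relWord_cons, map_mul, map_mul, spell_letter, spell_inl, skel_cons, List.length_cons,
      phiW_cons_succ, ofAdd_add, SemidirectProduct.mul_right, ih]
    simp

/-- The lift of the word of `t :: T` starting at height `a`. -/
theorem shiftHom_spell_relWord_cons (θ : X → ℤ) (t : X × Bool × H) (T : List (X × Bool × H))
    (a : ℤ) :
    shiftHom X H a (spell θ (relWord (t :: T))).left =
      cond t.2.1 (edge (min a (a + letterWeight θ (t.1, t.2.1))) t.1)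
          (edge (min a (a + letterWeight θ (t.1, t.2.1))) t.1)⁻¹ *
        (vert (a + letterWeight θ (t.1, t.2.1)) t.2.2 *
          shiftHom X H (a + letterWeight θ (t.1, t.2.1)) (spell θ (relWord T)).left) := by
  have hmin : ∀ w : ℤ, a + min 0 w = min a (a + w) := fun w => by
    rw [← min_add_add_left, add_zero]
  rw [relWord_cons, map_mul, map_mul, spell_letter, spell_inl]
  obtain ⟨x, b, h⟩ := t
  cases b <;> simp [hmin, mul_assoc]

/-- An endomorphism fixing all letters of a path fixes the path. -/
theorem map_shiftHom_spell_relWord (θ : X → ℤ) (τ : Cover X H →* Cover X H)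
    (hv : ∀ n h, τ (vert n h) = vert n h) (T : List (X × Bool × H)) (a : ℤ)
    (he : ∀ (k : ℕ) (hk : k < (skel T).length),
      τ (edge (a + min (phiW θ (skel T) k) (phiW θ (skel T) (k + 1))) ((skel T)[k]).1) =
        edge (a + min (phiW θ (skel T) k) (phiW θ (skel T) (k + 1))) ((skel T)[k]).1) :
    τ (shiftHom X H a (spell θ (relWord T)).left) =
      shiftHom X H a (spell θ (relWord T)).left := by
  induction T generalizing a with
  | nil => simp [relWord]
  | cons t T ih =>
    have h0 : τ (edge (a + min (phiW θ (skel (t :: T)) 0) (phiW θ (skel (t :: T)) (0 + 1))) t.1) =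
        edge (a + min (phiW θ (skel (t :: T)) 0) (phiW θ (skel (t :: T)) (0 + 1))) t.1 :=
      he 0 (by simp [skel])
    rw [← min_add_add_left, skel_cons, phiW_cons_succ, phiW_zero, phiW_zero, add_zero,
      add_zero] at h0
    rw [shiftHom_spell_relWord_cons, map_mul, map_mul, hv, ih]
    · congr 1
      obtain ⟨x, b, h⟩ := t
      cases b
      · simpa using h0
      · simpa using h0
    · intro k hk
      have := he (k + 1) (by simpa [skel] using hk)
      simp only [skel_cons, phiW_cons_succ, List.getElem_cons_succ] at this
      rwa [min_add_add_left, ← add_assoc] at this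


/-- The projection of `Cover X H` forgetting heights. -/
def forget : Cover X H →* Coprod H (FreeGroup X) := CoprodI.lift fun _ => MonoidHom.id _

@[simp]
theorem forget_edge (n : ℤ) (x : X) :
    forget (H := H) (edge n x) = Coprod.inr (FreeGroup.of x) := by
  simp [forget, edge]

@[simp]
theorem forget_vert (n : ℤ) (h : H) : forget (X := X) (vert n h) = Coprod.inl h := by
  simp [forget, vert]

theorem forget_shiftHom (n : ℤ) (u : Cover X H) : forget (shiftHom X H n u) = forget u := by
  have : forget.comp (shiftHom X H n) = forget := cover_hom_ext (by simp) (by simp)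
  exact DFunLike.congr_fun this u

theorem forget_spell (θ : X → ℤ) (w : Coprod H (FreeGroup X)) :
    forget (spell θ w).left = w := by
  let F : Cover X H ⋊[shift X H] Multiplicative ℤ →* Coprod H (FreeGroup X) :=
    { toFun := fun p => forget p.left
      map_one' := by simp
      map_mul' := fun p q => by simp [forget_shiftHom] }
  have hF : F.comp (spell θ) = MonoidHom.id _ := by
    ext y
    · change forget (spell θ (Coprod.inl y)).left = Coprod.inl y
      simp [spell_inl]
    · change forget (spell θ (Coprod.inr (FreeGroup.of y))).left = Coprod.inr (FreeGroup.of y)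
      simp [spell]
  exact DFunLike.congr_fun hF w

variable (X H) in
/-- The endomorphism of `Cover X H` sending the generator `edge c p` to `g` and fixing all other
generators. -/
noncomputable def subst (c : ℤ) (p : X) (g : Cover X H) : Cover X H →* Cover X H := by
  classical
  exact CoprodI.lift fun n => Coprod.lift
    ((CoprodI.of (M := fun _ : ℤ => Coprod H (FreeGroup X)) (i := n)).comp Coprod.inl)
    (FreeGroup.lift fun x => if n = c ∧ x = p then g else edge n x)

theorem subst_vert (c : ℤ) (p : X) (g : Cover X H) (n : ℤ) (h : H) :
    subst X H c p g (vert n h) = vert n h := by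
  simp [subst, vert]

theorem subst_edge_self (c : ℤ) (p : X) (g : Cover X H) :
    subst X H c p g (edge c p) = g := by
  simp [subst, edge]

theorem subst_edge_of_ne {c : ℤ} {p : X} (g : Cover X H) {n : ℤ} {x : X}
    (h : ¬ (n = c ∧ x = p)) : subst X H c p g (edge n x) = edge n x := by
  simp [subst, edge, h]

/-- The lift of the relator starting at height `n`. -/
def relLift (θ : X → ℤ) (R : List (X × Bool × H)) (n : ℤ) : Cover X H :=
  shiftHom X H n (spell θ (relWord R)).left

/-- The letters of a word with a unique minimum at `l` other than the `l`-th one lie above the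
minimum, or are different from the `l`-th one. -/
theorem lt_or_ne_of_unique_min {θ : X → ℤ} {W : List (X × Bool)} (hadm : IsAdmissible θ W)
    {l : Fin W.length}
    (hmin : ∀ j : Fin W.length, j ≠ l → phiW θ W (l.1 + 1) < phiW θ W (j.1 + 1))
    (hne : (W.get l).1 ≠ (W.get (succIdx W l)).1) (k : ℕ) (hk : k < W.length) (hkl : k ≠ l) :
    phiW θ W (l + 1) < min (phiW θ W k) (phiW θ W (k + 1)) ∨ W[k].1 ≠ W[l].1 := by
  by_cases hs : (⟨k, hk⟩ : Fin W.length) = succIdx W l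
  · right
    intro h
    rw [← hs] at hne
    exact hne h.symm
  · left
    have hs' : k ≠ (l + 1) % W.length := fun h => hs (Fin.ext h)
    refine lt_min ?_ (hmin ⟨k, hk⟩ fun h => hkl (congrArg Fin.val h))
    have hl := l.2
    rcases Nat.eq_zero_or_pos k with rfl | hpos
    · have hlast : l.1 ≠ W.length - 1 := fun h => hs' (by
        rw [h, Nat.sub_add_cancel hk, Nat.mod_self])
      have := hmin ⟨W.length - 1, by omega⟩ fun h => hlast (congrArg Fin.val h).symm
      rw [Nat.sub_add_cancel hk, show phiW θ W W.length = 0 from hadm] at this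
      rwa [phiW_zero]
    · have := hmin ⟨k - 1, by omega⟩ fun h => hs' (by
        have h' : k - 1 = l.1 := congrArg Fin.val h
        rw [← h', Nat.sub_add_cancel hpos, Nat.mod_eq_of_lt hk])
      rwa [Nat.sub_add_cancel hpos] at this

/-- The minimum of the graph of an admissible word is at most the height of any letter. -/
theorem min_le_of_unique_min {θ : X → ℤ} {W : List (X × Bool)} (hadm : IsAdmissible θ W)
    {l : Fin W.length}
    (hmin : ∀ j : Fin W.length, j ≠ l → phiW θ W (l.1 + 1) < phiW θ W (j.1 + 1))
    (k : ℕ) (hk : k ≤ W.length) : phiW θ W (l + 1) ≤ phiW θ W k := by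
  have hle : ∀ j : Fin W.length, phiW θ W (l.1 + 1) ≤ phiW θ W (j.1 + 1) := fun j => by
    by_cases h : j = l
    · rw [h]
    · exact (hmin j h).le
  have hl := l.2
  rcases Nat.eq_zero_or_pos k with rfl | hpos
  · have := hle ⟨W.length - 1, by omega⟩
    rw [Nat.sub_add_cancel (by omega), show phiW θ W W.length = 0 from hadm] at this
    rwa [phiW_zero]
  · have := hle ⟨k - 1, by omega⟩
    rwa [Nat.sub_add_cancel hpos] at this

/-- The lift of the relator at height `n` involves `edge (n + c) p` exactly once; all its other
letters `edge i x` satisfy `n + c < i`, or `n + c = i` and `x ≠ p`. -/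
theorem exists_relLift_eq {θ : X → ℤ} {R : List (X × Bool × H)} (h : UniqueMinWith θ (skel R)) :
    ∃ (c : ℤ) (p : X), ∀ n : ℤ, ∃ (A B : Cover X H) (b : Bool),
      relLift θ R n = A * cond b (edge (n + c) p) (edge (n + c) p)⁻¹ * B ∧
      ∀ τ : Cover X H →* Cover X H, (∀ i y, τ (vert i y) = vert i y) →
        (∀ i x, n + c < i ∨ n + c ≤ i ∧ x ≠ p → τ (edge i x) = edge i x) → τ A = A ∧ τ B = B := by
  obtain ⟨W, hW⟩ : ∃ W, W = skel R := ⟨_, rfl⟩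
  rw [← hW] at h
  obtain ⟨-, -, -, hadm, l, hmin, hne⟩ := h
  have hlen : W.length = R.length := by simp [hW, skel]
  have hlR : l.1 < R.length := hlen ▸ l.2
  have hget : ∀ (k : ℕ) (hk : k < R.length),
      W[k]'(hlen ▸ hk) = (R[k].1, R[k].2.1) := fun k hk => by simp [hW, skel]
  have hWl : W[l].1 = R[l.1].1 := congrArg Prod.fst (hget l hlR)
  refine ⟨phiW θ W (l + 1), R[l.1].1, fun n => ?_⟩
  have hR : R = R.take l ++ R[l.1] :: R.drop (l + 1) := by
    rw [← List.drop_eq_getElem_cons, List.take_append_drop]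
  have hstep : phiW θ W (l + 1) = phiW θ W l + letterWeight θ (R[l.1].1, R[l.1].2.1) := by
    rw [phiW_succ θ W l.2, hget l hlR]
  have hlow : min (phiW θ W l) (phiW θ W (l + 1)) = phiW θ W (l + 1) :=
    min_eq_right (min_le_of_unique_min hadm hmin l l.2.le)
  have htake : skel (R.take l) = W.take l := by simp [hW, skel]
  have hdrop : skel (R.drop (l + 1)) = W.drop (l + 1) := by simp [hW, skel]
  have hright : (spell θ (relWord (R.take l))).right = Multiplicative.ofAdd (phiW θ W l) := by
    rw [spell_relWord_right, htake, List.length_take, min_eq_left hlR.le, phiW_take _ _ le_rfl]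
  refine ⟨shiftHom X H n (spell θ (relWord (R.take l))).left,
    vert (n + phiW θ W (l + 1)) R[l.1].2.2 *
      shiftHom X H (n + phiW θ W (l + 1)) (spell θ (relWord (R.drop (l + 1)))).left,
    R[l.1].2.1, ?_, fun τ hv he => ⟨?_, ?_⟩⟩
  · rw [relLift]
    conv_lhs => rw [hR]
    rw [relWord_append, map_mul, SemidirectProduct.mul_left, map_mul, hright, shift_apply,
      shiftHom_shiftHom, shiftHom_spell_relWord_cons, toAdd_ofAdd, add_assoc, ← hstep,
      min_add_add_left, hlow, ← mul_assoc]
  · refine map_shiftHom_spell_relWord θ τ hv _ _ fun k hk => he _ _ ?_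
    simp only [htake] at hk ⊢
    have hkl : k < l := by simp at hk; omega
    rw [phiW_take _ _ hkl.le, phiW_take _ _ (show k + 1 ≤ l.1 from hkl), List.getElem_take]
    have hle := le_min (min_le_of_unique_min hadm hmin k (by omega))
      (min_le_of_unique_min hadm hmin (k + 1) (by omega))
    rcases lt_or_ne_of_unique_min hadm hmin hne k (by omega) hkl.ne with h | h
    · left; omega
    · refine .inr ⟨by omega, ?_⟩
      rwa [hWl] at h
  · rw [map_mul, hv]
    congr 1
    refine map_shiftHom_spell_relWord θ τ hv _ _ fun k hk => he _ _ ?_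
    simp only [hdrop] at hk ⊢
    have hkl : l + 1 + k < W.length := by simp at hk; omega
    rw [add_assoc, ← min_add_add_left, ← phiW_add, ← phiW_add, List.getElem_drop]
    have hle := le_min (min_le_of_unique_min hadm hmin (l + 1 + k) (by omega))
      (min_le_of_unique_min hadm hmin (l + 1 + k + 1) (by omega))
    rcases lt_or_ne_of_unique_min hadm hmin hne (l + 1 + k) (by omega) (by omega) with h | h
    · left
      rw [← add_assoc]
      omega
    · refine .inr ⟨by rw [← add_assoc]; omega, ?_⟩
      rwa [hWl] at h

/-- The projection of the free product to the group of the presentation. -/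
def mkHom (R : List (X × Bool × H)) : Coprod H (FreeGroup X) →* relGroup R :=
  QuotientGroup.mk' _

theorem mkHom_eq_one_iff {R : List (X × Bool × H)} {w : Coprod H (FreeGroup X)} :
    mkHom R w = 1 ↔ w ∈ Subgroup.normalClosure {relWord R} :=
  QuotientGroup.eq_one_iff w

theorem mkHom_surjective (R : List (X × Bool × H)) : Function.Surjective (mkHom R) :=
  QuotientGroup.mk'_surjective _

/-- The projection of `Cover X H` to the group of the presentation. -/
def toRelGroup (R : List (X × Bool × H)) : Cover X H →* relGroup R :=
  (mkHom R).comp forget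

theorem toRelGroup_relLift (θ : X → ℤ) (R : List (X × Bool × H)) (n : ℤ) :
    toRelGroup R (relLift θ R n) = 1 := by
  rw [relLift, toRelGroup, MonoidHom.comp_apply, forget_shiftHom, forget_spell]
  exact mkHom_eq_one_iff.2 (Subgroup.subset_normalClosure rfl)

/-- Finitely many consecutive lifted relators can be eliminated without changing the projection to
the group of the presentation. -/
theorem exists_hom_eliminating {θ : X → ℤ} {R : List (X × Bool × H)}
    (h : UniqueMinWith θ (skel R)) (d : ℕ) (m : ℤ) :
    ∃ σ : Cover X H →* Cover X H, (∀ j, m ≤ j → j < m + d → σ (relLift θ R j) = 1) ∧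
      ∀ u, toRelGroup R (σ u) = toRelGroup R u := by
  induction d generalizing m with
  | zero => exact ⟨MonoidHom.id _, fun j h1 h2 => by simp at h2; omega, fun _ => rfl⟩
  | succ d ih =>
    obtain ⟨σ, hσ, hσR⟩ := ih (m + 1)
    obtain ⟨c, p, hrel⟩ := exists_relLift_eq h
    obtain ⟨A, B, b, hAB, hfix⟩ := hrel m
    let g : Cover X H := cond b (A⁻¹ * B⁻¹) (A⁻¹ * B⁻¹)⁻¹
    have hsub : ∀ n, m ≤ n → ∀ i x, n + c < i ∨ n + c ≤ i ∧ x ≠ p →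
        subst X H (m + c) p g (edge i x) = edge i x := fun n hn i x hi =>
      subst_edge_of_ne g (by rintro ⟨rfl, rfl⟩; simp at hi; omega)
    have hg : toRelGroup R g = toRelGroup R (edge (m + c) p) := by
      have := toRelGroup_relLift θ R m
      rw [hAB] at this
      cases b
      · simp only [cond_false, map_mul, map_inv] at this
        simp only [g, cond_false, map_mul, map_inv]
        rw [mul_eq_one_iff_eq_inv, mul_inv_eq_iff_eq_mul] at this
        rw [this]
        group
      · simp only [cond_true, map_mul] at this
        simp only [g, cond_true, map_mul, map_inv]
        rw [mul_eq_one_iff_eq_inv] at this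
        rw [← this]
        group
    have hsubR : (toRelGroup R).comp (subst X H (m + c) p g) = toRelGroup R := by
      refine cover_hom_ext (fun n y => ?_) fun n x => ?_
      · rw [MonoidHom.comp_apply, subst_vert]
      · rw [MonoidHom.comp_apply]
        by_cases hnx : n = m + c ∧ x = p
        · obtain ⟨rfl, rfl⟩ := hnx
          rw [subst_edge_self, hg]
        · rw [subst_edge_of_ne g hnx]
    refine ⟨σ.comp (subst X H (m + c) p g), fun j h1 h2 => ?_, fun u => ?_⟩
    · rw [MonoidHom.comp_apply]
      rcases h1.eq_or_lt with rfl | hlt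
      · obtain ⟨hA, hB⟩ := hfix _ (subst_vert _ _ _) (hsub m le_rfl)
        have : subst X H (m + c) p g (relLift θ R m) = 1 := by
          rw [hAB, map_mul, map_mul, hA, hB]
          cases b <;> simp [subst_edge_self, g]
        rw [this, map_one]
      · obtain ⟨A', B', b', hAB', hfix'⟩ := hrel j
        obtain ⟨hA, hB⟩ := hfix' _ (subst_vert _ _ _) (hsub j h1)
        have he : subst X H (m + c) p g (edge (j + c) p) = edge (j + c) p :=
          subst_edge_of_ne g (by omega)
        have : subst X H (m + c) p g (relLift θ R j) = relLift θ R j := by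
          rw [hAB', map_mul, map_mul, hA, hB]
          cases b' <;> simp [he]
        rw [this]
        exact hσ j (by omega) (by push_cast at h2; omega)
    · rw [MonoidHom.comp_apply, hσR]
      exact DFunLike.congr_fun hsubR u

/-- A consequence of the relator lifts to a closed path which is killed as soon as finitely many
lifted relators are. -/
theorem spell_of_mem_normalClosure {θ : X → ℤ} {R : List (X × Bool × H)}
    (hadm : IsAdmissible θ (skel R)) {w : Coprod H (FreeGroup X)}
    (hw : w ∈ Subgroup.normalClosure {relWord R}) :
    (spell θ w).right = 1 ∧ ∃ M : ℕ, ∀ σ : Cover X H →* Cover X H,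
      (∀ j : ℤ, -M ≤ j → j ≤ M → σ (relLift θ R j) = 1) → σ (spell θ w).left = 1 := by
  have hR : (spell θ (relWord R)).right = 1 := by
    have hlen : R.length = (skel R).length := by simp [skel]
    rw [spell_relWord_right, hlen, show phiW θ (skel R) (skel R).length = 0 from hadm, ofAdd_zero]
  induction hw using Subgroup.closure_induction with
  | mem w hw =>
    obtain ⟨_, rfl, hc⟩ := Group.mem_conjugatesOfSet_iff.1 hw
    obtain ⟨v, rfl⟩ := isConj_iff.1 hc
    refine ⟨by simp [hR], (spell θ v).right.toAdd.natAbs, fun σ hσ => ?_⟩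
    have := hσ (spell θ v).right.toAdd (by omega) (by omega)
    rw [relLift] at this
    simp [SemidirectProduct.inv_left, hR, this, shiftHom_symm_shift]
  | one => exact ⟨by simp, 0, by simp⟩
  | mul x y _ _ hx hy =>
    obtain ⟨hx1, M, hM⟩ := hx
    obtain ⟨hy1, N, hN⟩ := hy
    refine ⟨by simp [hx1, hy1], M + N, fun σ hσ => ?_⟩
    have h1 := hM σ fun j _ _ => hσ j (by omega) (by omega)
    have h2 := hN σ fun j _ _ => hσ j (by omega) (by omega)
    simp [hx1, h1, h2]
  | inv x _ hx =>
    obtain ⟨hx1, M, hM⟩ := hx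
    exact ⟨by simp [hx1], M, fun σ hσ => by
      simp [SemidirectProduct.inv_left, hx1, hM σ hσ]⟩

/-- A finite subgroup of the group of the presentation lifts to `Cover X H`. -/
theorem exists_lift_of_finite {θ : X → ℤ} {R : List (X × Bool × H)}
    (h : UniqueMinWith θ (skel R)) (S : Subgroup (relGroup R)) [Finite S] :
    ∃ ψ : S →* Cover X H, ∀ s : S, toRelGroup R (ψ s) = s := by
  have hadm := h.2.2.2.1
  choose w hw using fun s : S => mkHom_surjective R s
  have hright : ∀ s, (spell θ (w s)).right = 1 := fun s => by
    obtain ⟨n, hn, hs⟩ := isOfFinOrder_iff_pow_eq_one.1 (isOfFinOrder_of_finite s)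
    have hmem : w s ^ n ∈ Subgroup.normalClosure {relWord R} := by
      rw [← mkHom_eq_one_iff, map_pow, hw]
      exact congrArg Subtype.val hs
    have := (spell_of_mem_normalClosure hadm hmem).1
    rw [map_pow, ← SemidirectProduct.rightHom_eq_right, map_pow] at this
    exact (pow_eq_one_iff_left hn.ne').1 this
  have hmul : ∀ q : S × S, w q.1 * w q.2 * (w (q.1 * q.2))⁻¹ ∈
      Subgroup.normalClosure {relWord R} := fun q => by
    rw [← mkHom_eq_one_iff, map_mul, map_mul, map_inv, hw, hw, hw]
    exact mul_inv_cancel _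
  choose M hM using fun q => (spell_of_mem_normalClosure hadm (hmul q)).2
  obtain ⟨N, hN⟩ := (Set.finite_range M).bddAbove
  obtain ⟨σ, hσ, hσR⟩ := exists_hom_eliminating h (2 * N + 1) (-N)
  refine ⟨MonoidHom.mk' (fun s => σ (spell θ (w s)).left) fun s t => ?_, fun s => ?_⟩
  · have hle : M (s, t) ≤ N := hN ⟨_, rfl⟩
    have := hM (s, t) σ fun j _ _ => hσ j (by omega) (by push_cast; omega)
    simp only [map_mul, map_inv, SemidirectProduct.mul_left, SemidirectProduct.mul_right,
      SemidirectProduct.inv_left, hright, shift_apply, inv_one, mul_one, toAdd_one,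
      shiftHom_zero, MonoidHom.id_apply] at this
    exact (mul_inv_eq_one.1 this).symm
  · rw [MonoidHom.mk'_apply, hσR, toRelGroup, MonoidHom.comp_apply, forget_spell, hw]

end Cover

end RelPres

/-- (Consequence (ii) of **Theorem 6**.) If `P = ⟨x, H; R⟩` is a relative
one-relator presentation whose `x`-skeleton has the unique min property with
respect to an admissible strict weight function, then every finite subgroup of
`G = G(P)` is contained in a conjugate of `ν(H)`. -/
theorem finite_subgroup_subconjugate_of_hasUniqueMin {X H : Type*} [Group H]
    (R : List (X × Bool × H)) (hP : HasUniqueMin (skel R))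
    (S : Subgroup (relGroup R)) (hS : Finite S) :
    ∃ g : relGroup R, ∀ s ∈ S, g * s * g⁻¹ ∈ (natHom R).range := by
  obtain ⟨θ, hθ⟩ := hP
  obtain ⟨ψ, hψ⟩ := RelPres.exists_lift_of_finite hθ S
  have htors : ∀ s ∈ ψ.range, IsOfFinOrder s := by
    rintro _ ⟨s, rfl⟩
    exact ψ.isOfFinOrder (isOfFinOrder_of_finite s)
  obtain ⟨n, g, hg⟩ := CoprodI.exists_conj_mem_range_of ψ.range htors
  let T : Subgroup (Coprod H (FreeGroup X)) :=
    (ψ.range.map (MulAut.conj g).toMonoidHom).map RelPres.forget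
  obtain ⟨g', hg'⟩ := Coprod.exists_conj_mem_range_inl T (by
    rintro _ ⟨_, ⟨s, hs, rfl⟩, rfl⟩
    exact RelPres.forget.isOfFinOrder ((MulAut.conj g).toMonoidHom.isOfFinOrder (htors s hs)))
  refine ⟨RelPres.mkHom R g' * RelPres.toRelGroup R g, fun s hs => ?_⟩
  obtain ⟨y, hy⟩ := hg' _ ⟨_, ⟨_, ⟨⟨s, hs⟩, rfl⟩, rfl⟩, rfl⟩
  refine ⟨y, ?_⟩
  have hfs : RelPres.mkHom R (RelPres.forget (ψ ⟨s, hs⟩)) = s := hψ ⟨s, hs⟩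
  change RelPres.mkHom R (Coprod.inl y) = _
  rw [hy]
  simp [RelPres.toRelGroup, hfs, mul_assoc]
end
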